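/- arXiv:2506.10471 — 2 statements merged into one kernel-verified Lean document; each statement's English description precedes it below -/
import Mathlib

section
/- Every K4-minor-free graph G of order n has an induced outerplanar subgraph of order at least 4n/5. -/
/-- A drawing (embedding) of a simple graph in the plane `ℝ × ℝ` without crossings:
vertices are mapped to distinct points, each edge to an injective arc joining its
endpoints, arcs pass through no other vertex, and two arcs of distinct edges meet
only in common endpoints. -/
structure PlaneEmbedding {V : Type} (G : SimpleGraph V) where
  vtx : V → ℝ × ℝ
  vtx_inj : Function.Injective vtx
  arc : ∀ ⦃u v : V⦄, G.Adj u v → Set (ℝ × ℝ)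
  arc_symm : ∀ ⦃u v : V⦄ (h : G.Adj u v), arc h.symm = arc h
  arc_path : ∀ ⦃u v : V⦄ (h : G.Adj u v),
    ∃ γ : Path (vtx u) (vtx v), Function.Injective ⇑γ ∧ Set.range ⇑γ = arc h
  arc_vtx : ∀ ⦃u v : V⦄ (h : G.Adj u v) (w : V), vtx w ∈ arc h → w = u ∨ w = v
  arc_inter : ∀ ⦃u v a b : V⦄ (h₁ : G.Adj u v) (h₂ : G.Adj a b), s(u, v) ≠ s(a, b) →
    arc h₁ ∩ arc h₂ ⊆ ({vtx u, vtx v} : Set (ℝ × ℝ)) ∩ {vtx a, vtx b}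

namespace PlaneEmbedding

variable {V : Type} {G : SimpleGraph V}

/-- The point set of the sub-drawing determined by the vertices in `S`
(the inherited embedding of the induced subgraph on `S`). -/
def subSupport (E : PlaneEmbedding G) (S : Set V) : Set (ℝ × ℝ) :=
  E.vtx '' S ∪ ⋃ (u : V) (_ : u ∈ S) (v : V) (_ : v ∈ S) (h : G.Adj u v), E.arc h

/-- The induced subgraph on `S`, with the inherited embedding, is an outerplane graph:
every vertex of `S` lies on the boundary of the outer (unbounded) face, i.e. in the
closure of the set of points belonging to unbounded faces of the sub-drawing. -/
def OuterplaneOn (E : PlaneEmbedding G) (S : Set V) : Prop :=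
  ∀ v ∈ S, E.vtx v ∈ closure {p | p ∉ E.subSupport S ∧
    ¬ Bornology.IsBounded (connectedComponentIn (E.subSupport S)ᶜ p)}

/-- The whole drawing is an outerplane graph. -/
def IsOuterplane (E : PlaneEmbedding G) : Prop := E.OuterplaneOn Set.univ

end PlaneEmbedding

/-- A graph is planar if it admits a plane embedding. -/
def IsPlanar {V : Type} (G : SimpleGraph V) : Prop := Nonempty (PlaneEmbedding G)

/-- A graph is outerplanar if it admits a plane embedding with all vertices on the
boundary of the outer face. -/
def IsOuterplanar {V : Type} (G : SimpleGraph V) : Prop :=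
  ∃ E : PlaneEmbedding G, E.IsOuterplane

/-- A plane triangulation is an edge-maximal (finite) planar graph. -/
def IsPlaneTriangulation {V : Type} (G : SimpleGraph V) : Prop :=
  IsPlanar G ∧ ∀ u v : V, u ≠ v → ¬ G.Adj u v →
    ¬ IsPlanar (G ⊔ SimpleGraph.fromEdgeSet {s(u, v)})

/-- `G` has a `K_m`-minor: there are `m` pairwise disjoint nonempty connected branch
sets with an edge between any two of them. -/
def HasCliqueMinor {V : Type} (G : SimpleGraph V) (m : ℕ) : Prop :=
  ∃ B : Fin m → Set V,
    (∀ i, (B i).Nonempty) ∧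
    (∀ i, (G.induce (B i)).Connected) ∧
    (∀ i j, i ≠ j → Disjoint (B i) (B j)) ∧
    (∀ i j, i ≠ j → ∃ u ∈ B i, ∃ v ∈ B j, G.Adj u v)

/-- `G` is `K₄`-minor free. -/
def K4MinorFree {V : Type} (G : SimpleGraph V) : Prop := ¬ HasCliqueMinor G 4

/-- `s_{o'}(G)` for a fixed plane embedding of `G`: the maximum order of an induced
subgraph whose inherited embedding is an outerplane graph. -/
noncomputable def sO' {V : Type} [Fintype V] {G : SimpleGraph V}
    (E : PlaneEmbedding G) : ℕ :=
  sSup {n | ∃ S : Finset V, E.OuterplaneOn ↑S ∧ S.card = n}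

/-- `s_o(G)`: the maximum order of an induced outerplanar subgraph of `G`. -/
noncomputable def sO {V : Type} [Fintype V] (G : SimpleGraph V) : ℕ :=
  sSup {n | ∃ S : Finset V, IsOuterplanar (G.induce (↑S : Set V)) ∧ S.card = n}

/-- `s_{K₄}(G)`: the maximum order of an induced `K₄`-minor-free subgraph of `G`. -/
noncomputable def sK4 {V : Type} [Fintype V] (G : SimpleGraph V) : ℕ :=
  sSup {n | ∃ S : Finset V, K4MinorFree (G.induce (↑S : Set V)) ∧ S.card = n}

/-- `tw(G) ≤ k`: `G` admits a tree decomposition of width at most `k`. -/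
def TreewidthLE {V : Type} (G : SimpleGraph V) (k : ℕ) : Prop :=
  ∃ (ι : Type) (T : SimpleGraph ι) (bag : ι → Set V),
    T.IsTree ∧
    (∀ v : V, ∃ i, v ∈ bag i) ∧
    (∀ u v : V, G.Adj u v → ∃ i, u ∈ bag i ∧ v ∈ bag i) ∧
    (∀ v : V, (T.induce {i | v ∈ bag i}).Connected) ∧
    (∀ i, (bag i).ncard ≤ k + 1)

/-- `G` is a `k`-tree: its vertices admit a construction order in which the first
`k+1` vertices form a complete graph and every later vertex is joined to exactly
`k` earlier, pairwise adjacent, vertices. -/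
def IsKTree (k : ℕ) {V : Type} (G : SimpleGraph V) : Prop :=
  ∃ (n : ℕ) (e : Fin n ≃ V), k + 1 ≤ n ∧
    (∀ i j : Fin n, (i : ℕ) < k + 1 → (j : ℕ) < k + 1 → i ≠ j → G.Adj (e i) (e j)) ∧
    (∀ j : Fin n, k + 1 ≤ (j : ℕ) →
      {i : Fin n | i < j ∧ G.Adj (e i) (e j)}.ncard = k ∧
      (∀ i i' : Fin n, i < j → i' < j → G.Adj (e i) (e j) → G.Adj (e i') (e j) →
        i ≠ i' → G.Adj (e i) (e i')))

/-- `S` is a dominating set of `G`. -/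
def IsDomSet {V : Type} (G : SimpleGraph V) (S : Set V) : Prop :=
  ∀ v : V, v ∈ S ∨ ∃ u ∈ S, G.Adj u v

/-- `S` is a connected dominating set of `G`. -/
def IsConnDomSet {V : Type} (G : SimpleGraph V) (S : Set V) : Prop :=
  IsDomSet G S ∧ (G.induce S).Connected

/-- The domination number `γ(G)`. -/
noncomputable def domNum {V : Type} [Fintype V] (G : SimpleGraph V) : ℕ :=
  sInf {n | ∃ S : Finset V, IsDomSet G ↑S ∧ S.card = n}

/-- The connected domination number `γ_c(G)`. -/
noncomputable def connDomNum {V : Type} [Fintype V] (G : SimpleGraph V) : ℕ :=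
  sInf {n | ∃ S : Finset V, IsConnDomSet G ↑S ∧ S.card = n}

/-- A graph is Eulerian if every vertex has even degree. -/
def IsEulerian {V : Type} (G : SimpleGraph V) : Prop :=
  ∀ v : V, Even (G.neighborSet v).ncard

/-- `G` contains a subgraph isomorphic to `H`. -/
def ContainsCopy {W V : Type} (H : SimpleGraph W) (G : SimpleGraph V) : Prop :=
  ∃ f : H →g G, Function.Injective ⇑f

/-- The complete tripartite graph `K_{1,1,3}`. -/
def K113 : SimpleGraph (Fin 5) :=
  SimpleGraph.fromEdgeSet {s(0, 1), s(0, 2), s(0, 3), s(0, 4), s(1, 2), s(1, 3), s(1, 4)}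

/-- `G` is a maximal outerplanar graph. -/
def IsMaximalOuterplanar {V : Type} (G : SimpleGraph V) : Prop :=
  IsOuterplanar G ∧ ∀ u v : V, u ≠ v → ¬ G.Adj u v →
    ¬ IsOuterplanar (G ⊔ SimpleGraph.fromEdgeSet {s(u, v)})

/-- The finite vertex set `S` cannot be split into two nonempty parts without edges between
them. -/
def Linked {V : Type} (G : SimpleGraph V) (S : Finset V) : Prop :=
  ∀ C ⊆ S, C.Nonempty → (∀ x ∈ C, ∀ y ∈ S, G.Adj x y → y ∈ C) → S ⊆ C

section Linked

variable {V : Type} {G : SimpleGraph V}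

lemma Linked.singleton (x : V) : Linked G {x} := by
  intro C hC hne _
  rw [Finset.Nonempty.subset_singleton_iff hne] at hC
  exact hC.ge

lemma Linked.induce_connected {S : Finset V} (hS : Linked G S) (hne : S.Nonempty) :
    (G.induce (S : Set V)).Connected := by
  classical
  have : Nonempty (S : Set V) := by
    obtain ⟨x, hx⟩ := hne
    exact ⟨⟨x, hx⟩⟩
  refine SimpleGraph.Connected.mk fun a b => ?_
  have key := hS (S.filter fun y => ∃ hy : y ∈ (S : Set V),
      (G.induce (S : Set V)).Reachable a ⟨y, hy⟩) (Finset.filter_subset _ _)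
    ⟨a, by
      simp only [Finset.mem_filter]
      exact ⟨a.2, a.2, SimpleGraph.Reachable.refl _⟩⟩ ?_
  · have hb := key b.2
    simp only [Finset.mem_filter] at hb
    obtain ⟨_, _, h⟩ := hb
    exact h
  · intro x hx y hy hxy
    simp only [Finset.mem_filter] at hx ⊢
    obtain ⟨_, hxS, h⟩ := hx
    refine ⟨hy, hy, h.trans (SimpleGraph.Adj.reachable ?_)⟩
    exact hxy

/-- A linked proper part of a linked set sends an edge out. -/
lemma Linked.exists_adj {S C : Finset V} (hS : Linked G S) (hC : C ⊆ S) (hne : C.Nonempty)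
    (hproper : ∃ y ∈ S, y ∉ C) : ∃ x ∈ C, ∃ y ∈ S, y ∉ C ∧ G.Adj x y := by
  by_contra! h
  obtain ⟨y, hy, hyC⟩ := hproper
  refine hyC (hS C hC hne (fun x hx z hz hxz => ?_) hy)
  by_contra hzC
  exact h x hx z hz hzC hxz

variable [DecidableEq V]

lemma Linked.union {X Y : Finset V} (hX : Linked G X) (hY : Linked G Y)
    (h : ∃ x ∈ X, ∃ y ∈ Y, x = y ∨ G.Adj x y) : Linked G (X ∪ Y) := by
  intro C hC hne hcl
  obtain ⟨x, hx, y, hy, hxy⟩ := h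
  have toX : (C ∩ X).Nonempty → X ⊆ C := fun hn =>
    (hX (C ∩ X) Finset.inter_subset_right hn (by grind)).trans Finset.inter_subset_left
  have toY : (C ∩ Y).Nonempty → Y ⊆ C := fun hn =>
    (hY (C ∩ Y) Finset.inter_subset_right hn (by grind)).trans Finset.inter_subset_left
  have hyx : y = x ∨ G.Adj y x := hxy.imp Eq.symm SimpleGraph.Adj.symm
  obtain ⟨c, hc⟩ := hne
  rcases Finset.mem_union.1 (hC hc) with hcX | hcY
  · have hXC := toX ⟨c, by grind⟩
    have hYC := toY ⟨y, by grind⟩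
    exact Finset.union_subset hXC hYC
  · have hYC := toY ⟨c, by grind⟩
    have hXC := toX ⟨x, by grind⟩
    exact Finset.union_subset hXC hYC

lemma Linked.insert_adj {X : Finset V} (hX : Linked G X) {a : V} (h : ∃ x ∈ X, G.Adj a x) :
    Linked G (insert a X) := by
  rw [Finset.insert_eq]
  obtain ⟨x, hx, hax⟩ := h
  exact (Linked.singleton a).union hX ⟨a, by simp, x, hx, Or.inr hax⟩

/-- Deleting from a linked set one side of a cut vertex leaves a linked set. -/
lemma Linked.insert_of_cut {A B : Finset V} {w : V} (h : Linked G (insert w (A ∪ B)))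
    (hwA : w ∉ A) (hAB : ∀ x ∈ A, ∀ y ∈ B, x ≠ y ∧ ¬ G.Adj x y) :
    Linked G (insert w B) := by
  intro C hC hne hcl
  by_cases hw : w ∈ C
  · have := h (C ∪ A) (by grind) ⟨w, by grind⟩ (by
      intro x hx y hy hxy
      have := hxy.symm
      grind)
    intro y hy
    have hyCA : y ∈ C ∪ A := this (by grind)
    rcases Finset.mem_union.1 hyCA with hyC | hyA
    · exact hyC
    · rcases Finset.mem_insert.1 hy with rfl | hyB
      · exact hw
      · exact absurd rfl (hAB y hyA y hyB).1
  · have := h C (by grind) hne (by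
      intro x hx y hy hxy
      have := hxy.symm
      grind)
    grind

/-- Every vertex of `T` lies in a connected component of `T`. -/
lemma exists_component (G : SimpleGraph V) {T : Finset V} {x : V} (hx : x ∈ T) :
    ∃ D ⊆ T, x ∈ D ∧ Linked G D ∧ ∀ y ∈ D, ∀ z ∈ T, G.Adj y z → z ∈ D := by
  classical
  set D : Finset V := T.filter fun y => ∀ C ⊆ T, x ∈ C →
    (∀ a ∈ C, ∀ b ∈ T, G.Adj a b → b ∈ C) → y ∈ C with hD
  have hmem : ∀ y, y ∈ D ↔ y ∈ T ∧ ∀ C ⊆ T, x ∈ C →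
      (∀ a ∈ C, ∀ b ∈ T, G.Adj a b → b ∈ C) → y ∈ C := by
    intro y
    rw [hD, Finset.mem_filter]
  have hDT : D ⊆ T := Finset.filter_subset _ _
  have hxD : x ∈ D := (hmem x).2 ⟨hx, fun _ _ h _ => h⟩
  have hcl : ∀ y ∈ D, ∀ z ∈ T, G.Adj y z → z ∈ D := by
    intro y hy z hz hyz
    rw [hmem] at hy ⊢
    exact ⟨hz, fun C hC hxC hCcl => hCcl y (hy.2 C hC hxC hCcl) z hz hyz⟩
  refine ⟨D, hDT, hxD, ?_, hcl⟩
  intro C hC hne hCcl y hy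
  by_cases hxC : x ∈ C
  · exact ((hmem y).1 hy).2 C (hC.trans hDT) hxC fun a ha b hb hab =>
      hCcl a ha b (hcl a (hC ha) b hb hab) hab
  · obtain ⟨c, hc⟩ := hne
    have := ((hmem c).1 (hC hc)).2 (D \ C) (Finset.sdiff_subset.trans hDT)
      (by grind) (by
        intro a ha b hb hab
        have hb' := hcl a (by grind) b hb hab
        have := hCcl b
        have := hab.symm
        grind)
    grind

/-- From a vertex of a linked set one can walk inside it until meeting `Z` for the first time. -/
lemma Linked.exists_first_hit {C Z : Finset V} (hC : Linked G C) {p : V} (hp : p ∈ C)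
    (hZ : ∃ z ∈ C, z ∈ Z) :
    ∃ C' ⊆ C, Linked G C' ∧ p ∈ C' ∧ ∃ z ∈ C', z ∈ Z ∧ ∀ y ∈ C', y ∈ Z → y = z := by
  by_cases hpZ : p ∈ Z
  · exact ⟨{p}, by grind, Linked.singleton p, by grind, p, by grind, hpZ, by grind⟩
  obtain ⟨D, hD, hpD, hDl, hDcl⟩ := exists_component G (T := C \ Z) (x := p) (by grind)
  obtain ⟨x, hx, y, hy, hyD, hxy⟩ := hC.exists_adj (C := D) (by grind) ⟨p, hpD⟩ (by grind)
  exact ⟨insert y D, by grind, hDl.insert_adj ⟨x, hx, hxy.symm⟩, by grind, y, by grind, by grind,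
    by grind⟩

/-- Either one vertex separates `P` from `Q` inside `D`, or `D` contains two disjoint linked
sets both meeting `P` and `Q`. -/
lemma exists_separator_or_disjoint_linked [Nonempty V] (Q : V → Prop) (D : Finset V) :
    ∀ P : V → Prop,
    (∃ w, ∀ C ⊆ D, w ∉ C → Linked G C → (∃ p ∈ C, P p) → ∀ q ∈ C, ¬ Q q) ∨
    ∃ X ⊆ D, ∃ Y ⊆ D, Disjoint X Y ∧ Linked G X ∧ Linked G Y ∧
      (∃ p ∈ X, P p) ∧ (∃ q ∈ X, Q q) ∧ (∃ p ∈ Y, P p) ∧ ∃ q ∈ Y, Q q := by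
  induction D using Finset.strongInduction with
  | H D ih =>
  intro P
  by_cases hsep : ∃ w, ∀ C ⊆ D, w ∉ C → Linked G C → (∃ p ∈ C, P p) → ∀ q ∈ C, ¬ Q q
  · exact Or.inl hsep
  right
  push Not at hsep
  obtain ⟨a, haD, haP⟩ : ∃ a ∈ D, P a := by
    obtain ⟨C, hCD, -, -, ⟨p, hp, hpP⟩, -⟩ := hsep (Classical.arbitrary V)
    exact ⟨p, hCD hp, hpP⟩
  obtain ⟨C, hCD, haC, hCl, ⟨p, hpC, hpP⟩, q, hqC, hqQ⟩ := hsep a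
  by_cases haQ : Q a
  · exact ⟨{a}, by grind, C, hCD, by simpa using haC, Linked.singleton a, hCl, by grind, by grind,
      ⟨p, hpC, hpP⟩, q, hqC, hqQ⟩
  rcases ih (D.erase a) (Finset.erase_ssubset haD) (fun x => P x ∨ G.Adj a x) with
    ⟨w, hw⟩ | ⟨X, hX, Y, hY, hXY, hXl, hYl, hXP, hXQ, hYP, hYQ⟩
  · exfalso
    obtain ⟨K, hKD, hwK, hKl, ⟨p', hp', hpP'⟩, q', hq', hqQ'⟩ := hsep w
    by_cases haK : a ∈ K
    · have hqa : q' ≠ a := by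
        rintro rfl
        exact haQ hqQ'
      obtain ⟨L, hL, hqL, hLl, hLcl⟩ :=
        exists_component G (T := K.erase a) (x := q') (by grind)
      obtain ⟨x, hx, y, hy, hyL, hxy⟩ :=
        hKl.exists_adj (C := L) (by grind) ⟨q', hqL⟩ ⟨a, haK, by grind⟩
      have hya : y = a := by
        by_contra hne
        exact hyL (hLcl x hx y (by grind) hxy)
      subst hya
      exact hw L (by grind) (by grind) hLl ⟨x, hx, Or.inr hxy.symm⟩ q' hqL hqQ'
    · exact hw K (by grind) hwK hKl ⟨p', hp', Or.inl hpP'⟩ q' hq' hqQ'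
  -- attaching `a` to a linked set whose only access to `P` is through a neighbour of `a`
  have attach : ∀ Z : Finset V, Linked G Z → (∃ p ∈ Z, P p ∨ G.Adj a p) →
      ∃ Z' ⊆ insert a Z, Z ⊆ Z' ∧ Linked G Z' ∧ ∃ p ∈ Z', P p := by
    rintro Z hZ ⟨p, hp, hpP | hap⟩
    · exact ⟨Z, Finset.subset_insert _ _, subset_rfl, hZ, p, hp, hpP⟩
    · exact ⟨insert a Z, subset_rfl, Finset.subset_insert _ _, hZ.insert_adj ⟨p, hp, hap⟩, a,
        by simp, haP⟩
  -- the case where a `P`-`Q` connection avoiding `a` first meets `X`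
  have finish : ∀ X Y C' : Finset V, X ⊆ D.erase a → Y ⊆ D.erase a → Disjoint X Y →
      Linked G X → Linked G Y → (∃ q ∈ X, Q q) → (∃ p ∈ Y, P p ∨ G.Adj a p) → (∃ q ∈ Y, Q q) →
      C' ⊆ C → Linked G C' → p ∈ C' → (∃ z ∈ C', z ∈ X) → Disjoint C' Y →
      ∃ X ⊆ D, ∃ Y ⊆ D, Disjoint X Y ∧ Linked G X ∧ Linked G Y ∧
      (∃ p ∈ X, P p) ∧ (∃ q ∈ X, Q q) ∧ (∃ p ∈ Y, P p) ∧ ∃ q ∈ Y, Q q := by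
    rintro X Y C' hX hY hXY hXl hYl ⟨q, hq, hqQ⟩ hYP ⟨r, hr, hrQ⟩ hC'C hC'l hpC' ⟨z, hz, hzX⟩ hC'Y
    obtain ⟨Y', hY', hYY', hYl', hYP'⟩ := attach Y hYl hYP
    refine ⟨C' ∪ X, by grind, Y', by grind, ?_, hC'l.union hXl ⟨z, hz, z, hzX, Or.inl rfl⟩, hYl',
      ⟨p, by grind, hpP⟩, ⟨q, by grind, hqQ⟩, hYP', r, hYY' hr, hrQ⟩
    rw [Finset.disjoint_left] at *
    grind
  by_cases hhit : ∃ z ∈ C, z ∈ X ∪ Y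
  · obtain ⟨C', hC', hCl', hpC', z, hz, hzXY, huniq⟩ := hCl.exists_first_hit hpC hhit
    rcases Finset.mem_union.1 hzXY with hzX | hzY
    · refine finish X Y C' hX hY hXY hXl hYl hXQ hYP hYQ hC' hCl' hpC' ⟨z, hz, hzX⟩ ?_
      rw [Finset.disjoint_left] at *
      grind
    · refine finish Y X C' hY hX hXY.symm hYl hXl hYQ hXP hXQ hC' hCl' hpC' ⟨z, hz, hzY⟩ ?_
      rw [Finset.disjoint_left] at *
      grind
  · obtain ⟨Y', hY', hYY', hYl', hYP'⟩ := attach Y hYl hYP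
    obtain ⟨r, hr, hrQ⟩ := hYQ
    refine ⟨C, hCD, Y', by grind, ?_, hCl, hYl', ⟨p, hpC, hpP⟩, ⟨q, hqC, hqQ⟩, hYP', r,
      hYY' hr, hrQ⟩
    rw [Finset.disjoint_left]
    grind

/-- Two disjoint linked subsets of a linked set can be grown until they are adjacent. -/
lemma Linked.exists_adjacent_superset {D X Y : Finset V} (hD : Linked G D) (hX : X ⊆ D)
    (hY : Y ⊆ D) (hXY : Disjoint X Y) (hXl : Linked G X) (hXne : X.Nonempty)
    (hYne : Y.Nonempty) :
    ∃ X' ⊆ D, X ⊆ X' ∧ Disjoint X' Y ∧ Linked G X' ∧ ∃ x ∈ X', ∃ y ∈ Y, G.Adj x y := by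
  obtain ⟨x₀, hx₀⟩ := hXne
  obtain ⟨y₀, hy₀⟩ := hYne
  rw [Finset.disjoint_left] at hXY
  obtain ⟨X', hX', hxX', hXl', hXcl⟩ :=
    exists_component G (T := D \ Y) (x := x₀) (by grind)
  have hXX' : X ⊆ X' :=
    (hXl (X ∩ X') Finset.inter_subset_left ⟨x₀, by grind⟩ (by grind)).trans
      Finset.inter_subset_right
  obtain ⟨x, hx, y, hy, hyX, hxy⟩ :=
    hD.exists_adj (C := X') (by grind) ⟨x₀, hxX'⟩ ⟨y₀, by grind, by grind⟩
  refine ⟨X', by grind, hXX', ?_, hXl', x, hx, y, ?_, hxy⟩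
  · rw [Finset.disjoint_left]
    grind
  · by_contra hyY
    exact hyX (hXcl x hx y (by grind) hxy)

end Linked

/-- The vertices of `S` can be placed on a line so that no two edges inside `S`, drawn on one
side of the line, cross. -/
def OnePage {V : Type} (G : SimpleGraph V) (S : Finset V) : Prop :=
  ∃ f : V → ℤ, Set.InjOn f S ∧ ∀ a ∈ S, ∀ b ∈ S, ∀ c ∈ S, ∀ d ∈ S,
    f a < f b → f b < f c → f c < f d → G.Adj a c → ¬ G.Adj b d

section Parabola

/-- The point of the parabola `y = x ^ 2` with abscissa `t`. -/
def parabolaPoint (t : ℝ) : ℝ × ℝ := (t, t ^ 2)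

lemma parabolaPoint_injective : Function.Injective parabolaPoint := fun _ _ h =>
  congrArg Prod.fst h

lemma mem_chord {a b : ℝ} {p : ℝ × ℝ} (hp : p ∈ segment ℝ (parabolaPoint a) (parabolaPoint b)) :
    p.2 - p.1 ^ 2 = (p.1 - a) * (b - p.1) ∧ 0 ≤ (p.1 - a) * (b - p.1) := by
  obtain ⟨s, t, hs, ht, hst, rfl⟩ := hp
  obtain rfl : s = 1 - t := by linarith
  simp only [parabolaPoint, Prod.smul_mk, Prod.mk_add_mk, smul_eq_mul]
  constructor
  · ring
  · have : (((1 - t) * a + t * b) - a) * (b - ((1 - t) * a + t * b)) =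
        t * (1 - t) * (b - a) ^ 2 := by ring
    rw [this]
    positivity

lemma eq_parabolaPoint_of_mem_chord {a b c : ℝ} {p : ℝ × ℝ}
    (hp : p ∈ segment ℝ (parabolaPoint a) (parabolaPoint b)) (hc : p.1 = c)
    (hab : c = a ∨ c = b) : p = parabolaPoint c := by
  have h := (mem_chord hp).1
  subst hc
  have : p.2 = p.1 ^ 2 := by
    rcases hab with h' | h' <;> rw [← h'] at h <;> linarith
  exact Prod.ext rfl this

/-- Distinct non-crossing chords of the parabola meet at common endpoints only. -/
lemma endpoint_of_chord_eq {a b c d x : ℝ} (hab : a < b) (hcd : c < d) (hne : a ≠ c ∨ b ≠ d)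
    (h₁ : 0 ≤ (x - a) * (b - x)) (h₂ : 0 ≤ (x - c) * (d - x))
    (he : (x - a) * (b - x) = (x - c) * (d - x))
    (hcross : ¬ (a < c ∧ c < b ∧ b < d)) (hcross' : ¬ (c < a ∧ a < d ∧ d < b)) :
    (x = a ∨ x = b) ∧ (x = c ∨ x = d) := by
  have range : ∀ {a b : ℝ}, a < b → 0 ≤ (x - a) * (b - x) → a ≤ x ∧ x ≤ b := by
    intro a b hab h
    constructor <;> by_contra! hlt <;> nlinarith
  -- the nested case
  have nested : ∀ {a b c d : ℝ}, a < b → c < d → (a ≠ c ∨ b ≠ d) →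
      (x - a) * (b - x) = (x - c) * (d - x) → a ≤ c → d ≤ b → c ≤ x → x ≤ d →
      (x = a ∨ x = b) ∧ (x = c ∨ x = d) := by
    intro a b c d hab hcd hne he hac hdb hcx hxd
    rcases hcx.eq_or_lt with rfl | hcx
    · have : (c - a) * (b - c) = 0 := by rw [he]; ring
      rcases mul_eq_zero.1 this with h | h
      · exact ⟨Or.inl (by linarith), Or.inl rfl⟩
      · exact ⟨Or.inr (by linarith), Or.inl rfl⟩
    rcases hxd.eq_or_lt with rfl | hxd
    · have : (x - a) * (b - x) = 0 := by rw [he]; ring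
      rcases mul_eq_zero.1 this with h | h
      · exact ⟨Or.inl (by linarith), Or.inr rfl⟩
      · exact ⟨Or.inr (by linarith), Or.inr rfl⟩
    exfalso
    have h : (c - a) * (b - x) + (x - c) * (b - d) = 0 := by linarith
    have h1 : 0 ≤ (c - a) * (b - x) := mul_nonneg (by linarith) (by linarith)
    have h2 : 0 ≤ (x - c) * (b - d) := mul_nonneg (by linarith) (by linarith)
    have h3 : c - a = 0 := by
      have : (c - a) * (b - x) = 0 := by linarith
      exact (mul_eq_zero.1 this).resolve_right (by linarith)
    have h4 : b - d = 0 := by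
      have : (x - c) * (b - d) = 0 := by linarith
      exact (mul_eq_zero.1 this).resolve_left (by linarith)
    rcases hne with h | h
    · exact h (by linarith)
    · exact h (by linarith)
  obtain ⟨hax, hxb⟩ := range hab h₁
  obtain ⟨hcx, hxd⟩ := range hcd h₂
  rcases le_total a c with hac | hca <;> rcases le_total d b with hdb | hbd
  · exact nested hab hcd hne he hac hdb hcx hxd
  · rcases hac.eq_or_lt with rfl | hac
    · exact (nested hcd hab (hne.imp Ne.symm Ne.symm) he.symm le_rfl hbd hax hxb).symm
    rcases hbd.eq_or_lt with rfl | hbd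
    · exact nested hab hcd hne he hac.le le_rfl hcx hxd
    have hbc : b ≤ c := not_lt.1 fun h => hcross ⟨hac, h, hbd⟩
    exact ⟨Or.inr (by linarith), Or.inl (by linarith)⟩
  · rcases hca.eq_or_lt with rfl | hca
    · exact nested hab hcd hne he le_rfl hdb hcx hxd
    rcases hdb.eq_or_lt with rfl | hdb
    · exact (nested hcd hab (hne.imp Ne.symm Ne.symm) he.symm hca.le le_rfl hax hxb).symm
    have hda : d ≤ a := not_lt.1 fun h => hcross' ⟨hca, h, hdb⟩
    exact ⟨Or.inl (by linarith), Or.inr (by linarith)⟩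
  · exact (nested hcd hab (hne.imp Ne.symm Ne.symm) he.symm hca hbd hax hxb).symm

/-- A plane drawing by chords of the parabola is outerplanar. -/
lemma isOuterplanar_of_noncrossing {W : Type} (H : SimpleGraph W) (f : W → ℝ)
    (hf : Function.Injective f)
    (hcross : ∀ a b c d, f a < f b → f b < f c → f c < f d → H.Adj a c → ¬ H.Adj b d) :
    IsOuterplanar H := by
  have chords : ∀ ⦃u v a b : W⦄, H.Adj u v → H.Adj a b → s(u, v) ≠ s(a, b) → ∀ x : ℝ,
      0 ≤ (x - f u) * (f v - x) → 0 ≤ (x - f a) * (f b - x) →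
      (x - f u) * (f v - x) = (x - f a) * (f b - x) →
      (x = f u ∨ x = f v) ∧ (x = f a ∨ x = f b) := by
    have sorted : ∀ ⦃u v a b : W⦄, f u < f v → f a < f b → H.Adj u v → H.Adj a b →
        s(u, v) ≠ s(a, b) → ∀ x : ℝ,
        0 ≤ (x - f u) * (f v - x) → 0 ≤ (x - f a) * (f b - x) →
        (x - f u) * (f v - x) = (x - f a) * (f b - x) →
        (x = f u ∨ x = f v) ∧ (x = f a ∨ x = f b) := by
      intro u v a b huv hab h₁ h₂ hne x hx hx' he
      refine endpoint_of_chord_eq huv hab ?_ hx hx' he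
        (fun h => hcross u a v b h.1 h.2.1 h.2.2 h₁ h₂)
        (fun h => hcross a u b v h.1 h.2.1 h.2.2 h₂ h₁)
      by_contra! h
      exact hne (by rw [hf h.1, hf h.2])
    have half : ∀ ⦃u v a b : W⦄, f u < f v → H.Adj u v → H.Adj a b → s(u, v) ≠ s(a, b) → ∀ x : ℝ,
        0 ≤ (x - f u) * (f v - x) → 0 ≤ (x - f a) * (f b - x) →
        (x - f u) * (f v - x) = (x - f a) * (f b - x) →
        (x = f u ∨ x = f v) ∧ (x = f a ∨ x = f b) := by
      intro u v a b huv h₁ h₂ hne x hx hx' he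
      rcases lt_or_gt_of_ne (hf.ne h₂.ne) with h | h
      · exact sorted huv h h₁ h₂ hne x hx hx' he
      · have := sorted huv h h₁ h₂.symm (by rwa [Sym2.eq_swap (a := b)]) x hx (by linarith)
          (by linarith)
        exact ⟨this.1, this.2.symm⟩
    intro u v a b h₁ h₂ hne x hx hx' he
    rcases lt_or_gt_of_ne (hf.ne h₁.ne) with h | h
    · exact half h h₁ h₂ hne x hx hx' he
    · have := half h h₁.symm h₂ (by rwa [Sym2.eq_swap (a := v)]) x (by linarith) hx'
          (by linarith)
      exact ⟨this.1.symm, this.2⟩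
  let E : PlaneEmbedding H :=
    { vtx := fun w => parabolaPoint (f w)
      vtx_inj := parabolaPoint_injective.comp hf
      arc := fun u v _ => segment ℝ (parabolaPoint (f u)) (parabolaPoint (f v))
      arc_symm := fun u v _ => segment_symm ℝ _ _
      arc_path := fun u v h => ⟨Path.segment _ _,
        Path.segment_injective_of_ne ((parabolaPoint_injective.comp hf).ne h.ne),
        Path.range_segment _ _⟩
      arc_vtx := by
        intro u v h w hw
        have h₀ : (f w - f u) * (f v - f w) = 0 := by
          have := (mem_chord hw).1
          simp only [parabolaPoint, sub_self] at this
          exact this.symm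
        rcases mul_eq_zero.1 h₀ with h' | h'
        · exact Or.inl (hf (by linarith))
        · exact Or.inr (hf (by linarith))
      arc_inter := by
        rintro u v a b h₁ h₂ hne p ⟨hp₁, hp₂⟩
        obtain ⟨e₁, n₁⟩ := mem_chord hp₁
        obtain ⟨e₂, n₂⟩ := mem_chord hp₂
        obtain ⟨r₁, r₂⟩ := chords h₁ h₂ hne p.1 n₁ n₂ (e₁.symm.trans e₂)
        have hp := eq_parabolaPoint_of_mem_chord hp₁ rfl r₁
        constructor
        · rcases r₁ with r | r <;> rw [r] at hp <;> simp [hp]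
        · rcases r₂ with r | r <;> rw [r] at hp <;> simp [hp] }
  have above : ∀ p ∈ E.subSupport Set.univ, p.1 ^ 2 ≤ p.2 := by
    rintro p (⟨w, -, rfl⟩ | hp)
    · exact le_refl _
    · simp only [Set.mem_iUnion] at hp
      obtain ⟨u, -, v, -, h, hp⟩ := hp
      have := mem_chord (a := f u) (b := f v) hp
      linarith [this.1, this.2]
  refine ⟨E, fun w _ => Metric.mem_closure_iff.2 fun ε hε => ?_⟩
  set t := f w with ht
  have hray : (fun y : ℝ => (t, y)) '' Set.Iio (t ^ 2) ⊆ (E.subSupport Set.univ)ᶜ := by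
    rintro _ ⟨y, hy, rfl⟩ hmem
    exact absurd (above _ hmem) (not_le.2 hy)
  have hmem : t ^ 2 - ε / 2 ∈ Set.Iio (t ^ 2) := by
    simp only [Set.mem_Iio]
    linarith
  refine ⟨(t, t ^ 2 - ε / 2), ⟨hray ⟨_, hmem, rfl⟩, fun hb => ?_⟩, ?_⟩
  · have hsub := (isPreconnected_Iio.image (fun y : ℝ => (t, y))
      (by fun_prop)).subset_connectedComponentIn ⟨_, hmem, rfl⟩ hray
    have hb' := ((hb.subset hsub).image_snd).bddBelow
    obtain ⟨m, hm⟩ := hb'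
    have := hm (a := min m (t ^ 2) - 1) ⟨(t, min m (t ^ 2) - 1), ⟨_, by
      simp only [Set.mem_Iio]
      linarith [min_le_right m (t ^ 2)], rfl⟩, rfl⟩
    linarith [min_le_left m (t ^ 2)]
  · change dist (t, t ^ 2) (t, t ^ 2 - ε / 2) < ε
    rw [Prod.dist_eq, dist_self, Real.dist_eq, sub_sub_cancel, abs_of_pos (by positivity)]
    exact max_lt hε (by linarith)

lemma OnePage.isOuterplanar {V : Type} {G : SimpleGraph V} {S : Finset V} (h : OnePage G S) :
    IsOuterplanar (G.induce (S : Set V)) := by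
  obtain ⟨f, hf, hcross⟩ := h
  refine isOuterplanar_of_noncrossing _ (fun x => (f x : ℝ)) (fun x y hxy => ?_) ?_
  · exact Subtype.ext (hf x.2 y.2 (Int.cast_injective hxy))
  · intro a b c d hab hbc hcd hac hbd
    exact hcross a a.2 b b.2 c c.2 d d.2 (by exact_mod_cast hab) (by exact_mod_cast hbc)
      (by exact_mod_cast hcd) hac hbd

end Parabola

section OnePage

variable {V : Type} {G : SimpleGraph V}

lemma OnePage.mono {S T : Finset V} (h : OnePage G T) (hST : S ⊆ T) : OnePage G S := by
  obtain ⟨f, hf, hcross⟩ := h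
  exact ⟨f, hf.mono (by exact_mod_cast hST), fun a ha b hb c hc d hd =>
    hcross a (hST ha) b (hST hb) c (hST hc) d (hST hd)⟩

lemma exists_bound (f : V → ℤ) (S : Finset V) : ∃ N : ℤ, ∀ x ∈ S, f x < N ∧ -N < f x := by
  obtain ⟨M, hM⟩ := (S.image fun x => |f x|).exists_le
  refine ⟨M + 1, fun x hx => ?_⟩
  have := abs_le.1 (hM _ (Finset.mem_image_of_mem _ hx))
  omega

/-- A one-page layout can be rotated so that a prescribed vertex comes first, at position `0`. -/
lemma OnePage.exists_first {S : Finset V} (h : OnePage G S) {c : V} (hc : c ∈ S) :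
    ∃ f : V → ℤ, f c = 0 ∧ (∀ x ∈ S, x ≠ c → 0 < f x) ∧ Set.InjOn f S ∧
      ∀ a ∈ S, ∀ b ∈ S, ∀ c ∈ S, ∀ d ∈ S,
        f a < f b → f b < f c → f c < f d → G.Adj a c → ¬ G.Adj b d := by
  obtain ⟨f, hf, hcross⟩ := h
  obtain ⟨N, hN⟩ := exists_bound (fun x => f x - f c) S
  have hinj : ∀ x ∈ S, ∀ y ∈ S, f x = f y → x = y := fun x hx y hy h => hf hx hy h
  refine ⟨fun x => if f x < f c then f x - f c + 2 * N else f x - f c, by simp, ?_, ?_, ?_⟩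
  · intro x hx hxc
    have := hN x hx
    have := hinj x hx c hc
    dsimp only
    split_ifs <;> grind
  · intro x hx y hy hxy
    have := hN x hx
    have := hN y hy
    dsimp only at hxy
    refine hf hx hy ?_
    split_ifs at hxy <;> omega
  · intro p hp q hq r hr s hs hpq hqr hrs hpr hqs
    have h₁ := hN p hp
    have h₂ := hN q hq
    have h₃ := hN r hr
    have h₄ := hN s hs
    have c₁ := hcross p hp q hq r hr s hs
    have c₂ := hcross q hq r hr s hs p hp
    have c₃ := hcross r hr s hs p hp q hq
    have c₄ := hcross s hs p hp q hq r hr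
    have hrp := hpr.symm
    have hsq := hqs.symm
    simp only [hpr, hqs, hrp, hsq, not_true, imp_false, not_lt] at c₁ c₂ c₃ c₄
    dsimp only at hpq hqr hrs
    split_ifs at hpq hqr hrs <;> omega

variable [DecidableEq V]

/-- Two one-page layouts, one to the left and one to the right of a possible common vertex,
can be put side by side. -/
lemma OnePage.juxtapose {S T : Finset V} {f g : V → ℤ} (hf : Set.InjOn f S) (hg : Set.InjOn g T)
    (hfc : ∀ a ∈ S, ∀ b ∈ S, ∀ c ∈ S, ∀ d ∈ S,
      f a < f b → f b < f c → f c < f d → G.Adj a c → ¬ G.Adj b d)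
    (hgc : ∀ a ∈ T, ∀ b ∈ T, ∀ c ∈ T, ∀ d ∈ T,
      g a < g b → g b < g c → g c < g d → G.Adj a c → ¬ G.Adj b d)
    (hfn : ∀ x ∈ S, f x ≤ 0) (hgn : ∀ x ∈ T, 0 ≤ g x)
    (hcommon : ∀ x ∈ S, x ∈ T → f x = 0 ∧ g x = 0)
    (hzero : ∀ x ∈ S, ∀ y ∈ T, f x = 0 → g y = 0 → x = y)
    (hadj : ∀ x ∈ S, ∀ y ∈ T, G.Adj x y → x ∈ T ∨ y ∈ S) : OnePage G (S ∪ T) := by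
  have hS : ∀ x ∈ S, (if x ∈ S then f x else g x) = f x := fun x hx => if_pos hx
  have hT : ∀ x ∈ T, (if x ∈ S then f x else g x) = g x := by
    intro x hx
    split_ifs with h
    · rw [(hcommon x h hx).1, (hcommon x h hx).2]
    · rfl
  -- an edge of the union lies on one of the two sides
  have hside : ∀ x ∈ S ∪ T, ∀ y ∈ S ∪ T, G.Adj x y → (x ∈ S ∧ y ∈ S) ∨ (x ∈ T ∧ y ∈ T) := by
    intro x hx y hy hxy
    have := hxy.symm
    grind
  refine ⟨fun x => if x ∈ S then f x else g x, ?_, ?_⟩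
  · have hf' : ∀ x ∈ S, ∀ y ∈ S, f x = f y → x = y := fun x hx y hy h => hf hx hy h
    have hg' : ∀ x ∈ T, ∀ y ∈ T, g x = g y → x = y := fun x hx y hy h => hg hx hy h
    intro x hx y hy hxy
    rw [Finset.mem_coe, Finset.mem_union] at hx hy
    dsimp only at hxy
    grind
  · intro a ha b hb c hc d hd hab hbc hcd hac hbd
    dsimp only at hab hbc hcd
    rcases hside a ha c hc hac with ⟨ha', hc'⟩ | ⟨ha', hc'⟩ <;>
      rcases hside b hb d hd hbd with ⟨hb', hd'⟩ | ⟨hb', hd'⟩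
    · rw [hS a ha', hS b hb'] at hab
      rw [hS b hb', hS c hc'] at hbc
      rw [hS c hc', hS d hd'] at hcd
      exact hfc a ha' b hb' c hc' d hd' hab hbc hcd hac hbd
    · rw [hT b hb', hS c hc'] at hbc
      have := hfn c hc'
      have := hgn b hb'
      omega
    · rw [hT a ha', hS b hb'] at hab
      rw [hS b hb', hT c hc'] at hbc
      rw [hT c hc', hS d hd'] at hcd
      have := hgn a ha'
      have := hfn b hb'
      omega
    · rw [hT a ha', hT b hb'] at hab
      rw [hT b hb', hT c hc'] at hbc
      rw [hT c hc', hT d hd'] at hcd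
      exact hgc a ha' b hb' c hc' d hd' hab hbc hcd hac hbd

lemma OnePage.union_of_not_adj {S T : Finset V} (hS : OnePage G S) (hT : OnePage G T)
    (hST : ∀ x ∈ S, ∀ y ∈ T, x ≠ y ∧ ¬ G.Adj x y) : OnePage G (S ∪ T) := by
  obtain ⟨f, hf, hfc⟩ := hS
  obtain ⟨g, hg, hgc⟩ := hT
  obtain ⟨M, hM⟩ := exists_bound f S
  obtain ⟨N, hN⟩ := exists_bound g T
  refine OnePage.juxtapose (f := fun x => f x - M) (g := fun x => g x + N)
    ?_ ?_ ?_ ?_ ?_ ?_ ?_ ?_ ?_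
  · exact fun x hx y hy h => hf hx hy (by dsimp only at h; omega)
  · exact fun x hx y hy h => hg hx hy (by dsimp only at h; omega)
  · exact fun a ha b hb c hc d hd h₁ h₂ h₃ =>
      hfc a ha b hb c hc d hd (by omega) (by omega) (by omega)
  · exact fun a ha b hb c hc d hd h₁ h₂ h₃ =>
      hgc a ha b hb c hc d hd (by omega) (by omega) (by omega)
  · exact fun x hx => by have := hM x hx; omega
  · exact fun x hx => by have := hN x hx; omega
  · exact fun x hx hxT => absurd rfl (hST x hx x hxT).1
  · exact fun x hx y hy h => by have := hM x hx; omega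
  · exact fun x hx y hy h => absurd h (hST x hx y hy).2

/-- A one-page set may be enlarged by a one-page set attached to it at one vertex at most. -/
lemma OnePage.attach {S B : Finset V} {c : V} (hS : OnePage G S)
    (hB : OnePage G (insert c B)) (hSB : Disjoint S B)
    (hadj : ∀ x ∈ B, ∀ y ∈ S, G.Adj x y → y = c) :
    OnePage G (S ∪ B) := by
  rw [Finset.disjoint_left] at hSB
  by_cases hc : c ∈ S
  · obtain ⟨f, hf0, hfpos, hf, hfc⟩ := hS.exists_first hc
    obtain ⟨g, hg0, hgpos, hg, hgc⟩ := hB.exists_first (Finset.mem_insert_self c B)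
    have hunion : S ∪ B = S ∪ insert c B := by grind
    rw [hunion]
    refine OnePage.juxtapose (f := fun x => -f x) (g := g) ?_ hg ?_ hgc ?_ ?_ ?_ ?_ ?_
    · exact fun x hx y hy h => hf hx hy (by dsimp only at h; omega)
    · exact fun p hp q hq r hr s hs h₁ h₂ h₃ hpr hqs => hfc s hs r hr q hq p hp (by omega)
        (by omega) (by omega) hqs.symm hpr.symm
    · intro x hx
      have := hfpos x hx
      grind
    · intro x hx
      have := hgpos x hx
      grind
    · intro x hx hx'
      grind
    · intro x hx y hy h h'
      have := hfpos x hx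
      have := hgpos y hy
      grind
    · intro x hx y hy hxy
      have := hadj y
      have := hxy.symm
      grind
  · refine hS.union_of_not_adj (hB.mono (Finset.subset_insert c B)) fun x hx y hy => ⟨?_, ?_⟩
    · rintro rfl
      exact hSB hx hy
    · intro hxy
      exact hc (hadj y hy x hx hxy.symm ▸ hx)

lemma onePage_of_card_le_four (hG : K4MinorFree G) {S : Finset V} (hS : S.card ≤ 4) :
    OnePage G S := by
  rcases hS.lt_or_eq with hlt | hcard
  · let e := S.equivFin
    have he : ∀ x (hx : x ∈ S), (if h : x ∈ S then ((e ⟨x, h⟩ : ℕ) : ℤ) else 0) = (e ⟨x, hx⟩ : ℕ) :=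
      fun x hx => dif_pos hx
    refine ⟨fun x => if h : x ∈ S then (e ⟨x, h⟩ : ℕ) else 0, ?_, ?_⟩
    · intro x hx y hy hxy
      dsimp only at hxy
      rw [he x hx, he y hy] at hxy
      have := e.injective (Fin.ext (by exact_mod_cast hxy))
      exact congrArg Subtype.val this
    · intro a ha b hb c hc d hd hab hbc hcd
      dsimp only at hab hbc hcd
      rw [he a ha, he b hb] at hab
      rw [he b hb, he c hc] at hbc
      rw [he c hc, he d hd] at hcd
      have := (e ⟨d, hd⟩).isLt
      omega
  · obtain ⟨x, hx, y, hy, hxy, hnadj⟩ : ∃ x ∈ S, ∃ y ∈ S, x ≠ y ∧ ¬ G.Adj x y := by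
      by_contra! h
      let e := S.equivFinOfCardEq hcard
      refine hG ⟨fun i => {(e.symm i : V)}, fun i => Set.singleton_nonempty _, fun i => ?_,
        fun i j hij => ?_, fun i j hij => ?_⟩
      · have := (Linked.singleton (G := G) (e.symm i : V)).induce_connected
          (Finset.singleton_nonempty _)
        rwa [Finset.coe_singleton] at this
      · rw [Set.disjoint_singleton]
        exact fun h' => hij (e.symm.injective (Subtype.ext h'))
      · exact ⟨_, rfl, _, rfl, h _ (e.symm i).2 _ (e.symm j).2
          fun h' => hij (e.symm.injective (Subtype.ext h'))⟩
    have hcard' : ((S.erase x).erase y).card = 2 := by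
      rw [Finset.card_erase_of_mem (by grind), Finset.card_erase_of_mem hx, hcard]
    obtain ⟨p, q, hpq, hS'⟩ := Finset.card_eq_two.1 hcard'
    have hSmem : ∀ z, z ∈ S ↔ z = x ∨ z = y ∨ z = p ∨ z = q := by
      intro z
      have : z ∈ (S.erase x).erase y ↔ z = p ∨ z = q := by rw [hS']; simp
      grind
    have hne : p ≠ x ∧ p ≠ y ∧ q ≠ x ∧ q ≠ y := by
      have hp : p ∈ (S.erase x).erase y := by rw [hS']; simp
      have hq : q ∈ (S.erase x).erase y := by rw [hS']; simp
      grind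
    have hnadj' : ¬ G.Adj y x := fun h => hnadj h.symm
    let f : V → ℤ := fun z => if z = x then 0 else if z = p then 1 else if z = y then 2 else 3
    have hfx : f x = 0 := by grind
    have hfy : f y = 2 := by grind
    have hfp : f p = 1 := by grind
    have hfq : f q = 3 := by grind
    refine ⟨f, ?_, ?_⟩
    · intro a ha b hb hab
      rw [Finset.mem_coe, hSmem] at ha hb
      grind
    · intro a ha b hb c hc d hd hab hbc hcd hac
      rw [hSmem] at ha hb hc hd
      have ha0 : a = x := by grind
      have hc2 : c = y := by grind
      subst ha0 hc2
      exact absurd hac hnadj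

end OnePage

/-- Inside `W`, the set `T` is attached to the rest at `u` and `v` only, and `u` and `v` are
joined to each other outside `T`. -/
structure Rooted {V : Type} (G : SimpleGraph V) (W : Finset V) (u v : V) (T : Finset V) :
    Prop where
  subset : T ⊆ W
  left_mem : u ∈ W
  right_mem : v ∈ W
  left_notMem : u ∉ T
  right_notMem : v ∉ T
  closed : ∀ x ∈ T, ∀ y ∈ W, G.Adj x y → y ∈ T ∨ y = u ∨ y = v
  bond : ∃ U U' : Finset V, Linked G U ∧ Linked G U' ∧ u ∈ U ∧ v ∈ U' ∧ Disjoint U U' ∧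
    Disjoint U T ∧ Disjoint U' T ∧ ∃ a ∈ U, ∃ b ∈ U', G.Adj a b

namespace Rooted

variable {V : Type} {G : SimpleGraph V} {W T D A B : Finset V} {u v w : V}

lemma symm (h : Rooted G W u v T) : Rooted G W v u T := by
  obtain ⟨U, U', hU, hU', hu, hv, hd, hdT, hdT', a, ha, b, hb, hab⟩ := h.bond
  exact ⟨h.subset, h.right_mem, h.left_mem, h.right_notMem, h.left_notMem,
    fun x hx y hy hxy => (h.closed x hx y hy hxy).imp_right Or.symm,
    U', U, hU', hU, hv, hu, hd.symm, hdT', hdT, b, hb, a, ha, hab.symm⟩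

lemma ne (h : Rooted G W u v T) : u ≠ v := by
  obtain ⟨U, U', -, -, hu, hv, hd, -⟩ := h.bond
  rintro rfl
  exact Finset.disjoint_left.1 hd hu hv

lemma of_adj (hTW : T ⊆ W) (hu : u ∈ W) (hv : v ∈ W) (huT : u ∉ T) (hvT : v ∉ T)
    (huv : G.Adj u v) (hcl : ∀ x ∈ T, ∀ y ∈ W, G.Adj x y → y ∈ T ∨ y = u ∨ y = v) :
    Rooted G W u v T :=
  ⟨hTW, hu, hv, huT, hvT, hcl, {u}, {v}, Linked.singleton u, Linked.singleton v, by simp,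
    by simp, by simpa using huv.ne, by simpa using huT, by simpa using hvT, u, by simp, v,
    by simp, huv⟩

/-- A `K₄`-minor arises from two disjoint linked sets that are adjacent to each other and to
both roots. -/
lemma hasCliqueMinor (h : Rooted G W u v T) {X Y : Finset V} (hX : X ⊆ T) (hY : Y ⊆ T)
    (hXY : Disjoint X Y) (hXl : Linked G X) (hYl : Linked G Y)
    (hXu : ∃ x ∈ X, G.Adj u x) (hXv : ∃ x ∈ X, G.Adj v x) (hYu : ∃ y ∈ Y, G.Adj u y)
    (hYv : ∃ y ∈ Y, G.Adj v y) (hadj : ∃ x ∈ X, ∃ y ∈ Y, G.Adj x y) : HasCliqueMinor G 4 := by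
  obtain ⟨U, U', hU, hU', hu, hv, hd, hdT, hdT', hUU'⟩ := h.bond
  obtain ⟨x, hx, hux⟩ := hXu
  obtain ⟨x', hx', hvx⟩ := hXv
  obtain ⟨y, hy, huy⟩ := hYu
  obtain ⟨y', hy', hvy⟩ := hYv
  let F : Fin 4 → Finset V := ![U, U', X, Y]
  have hne : ∀ i, (F i).Nonempty := by
    intro i
    fin_cases i
    exacts [⟨u, hu⟩, ⟨v, hv⟩, ⟨x, hx⟩, ⟨y, hy⟩]
  have hl : ∀ i, Linked G (F i) := by
    intro i
    fin_cases i
    exacts [hU, hU', hXl, hYl]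
  have hlt : ∀ i j, i < j → Disjoint (F i) (F j) ∧ ∃ a ∈ F i, ∃ b ∈ F j, G.Adj a b := by
    intro i j hij
    fin_cases i <;> fin_cases j <;> first | exact absurd hij (by decide) | skip
    exacts [⟨hd, hUU'⟩, ⟨hdT.mono_right hX, u, hu, x, hx, hux⟩,
      ⟨hdT.mono_right hY, u, hu, y, hy, huy⟩, ⟨hdT'.mono_right hX, v, hv, x', hx', hvx⟩,
      ⟨hdT'.mono_right hY, v, hv, y', hy', hvy⟩, ⟨hXY, hadj⟩]
  refine ⟨fun i => (F i : Set V), fun i => by exact_mod_cast hne i,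
    fun i => (hl i).induce_connected (hne i), fun i j hij => ?_, fun i j hij => ?_⟩
  · rw [Finset.disjoint_coe]
    rcases lt_or_gt_of_ne hij with h | h
    · exact (hlt i j h).1
    · exact (hlt j i h).1.symm
  · rcases lt_or_gt_of_ne hij with h | h
    · obtain ⟨a, ha, b, hb, hab⟩ := (hlt i j h).2
      exact ⟨a, ha, b, hb, hab⟩
    · obtain ⟨a, ha, b, hb, hab⟩ := (hlt j i h).2
      exact ⟨b, hb, a, ha, hab.symm⟩

variable [DecidableEq V]

/-- One side of a cut vertex `w` of a component of `T` is again rooted. -/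
lemma of_cut (h : Rooted G W u v T) (hDT : insert w (A ∪ B) ⊆ T)
    (hDcl : ∀ x ∈ insert w (A ∪ B), ∀ y ∈ T, G.Adj x y → y ∈ insert w (A ∪ B))
    (hDl : Linked G (insert w (A ∪ B))) (hwA : w ∉ A)
    (hAB : ∀ x ∈ A, ∀ y ∈ B, x ≠ y ∧ ¬ G.Adj x y) (hAv : ∀ x ∈ A, ¬ G.Adj v x)
    (hvB : ∃ d ∈ insert w B, G.Adj v d) : Rooted G W u w A := by
  have hAT : A ⊆ T := by grind
  have hwT : w ∈ T := by grind
  refine ⟨hAT.trans h.subset, h.left_mem, h.subset hwT, fun hu => h.left_notMem (hAT hu), hwA,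
    ?_, ?_⟩
  · intro x hx y hy hxy
    have hxT := hAT hx
    have hc := h.closed x hxT y hy hxy
    have hyx := hxy.symm
    have hAv' := hAv x hx
    have hAB' := hAB x hx y
    have := hDcl x (by grind) y
    rcases hc with hc | rfl | rfl
    · have := this hc hxy
      grind
    · exact Or.inr (Or.inl rfl)
    · exact absurd hyx hAv'
  · obtain ⟨U, U', hU, hU', hu, hv, hd, hdT, hdT', a, ha, b, hb, hab⟩ := h.bond
    obtain ⟨d, hdB, hvd⟩ := hvB
    rw [Finset.disjoint_left] at hd hdT hdT'
    refine ⟨U, U' ∪ insert w B, hU,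
      hU'.union (hDl.insert_of_cut hwA hAB) ⟨v, hv, d, hdB, Or.inr hvd⟩, hu, by grind, ?_, ?_, ?_,
      a, ha, b, by grind, hab⟩
    · rw [Finset.disjoint_left]
      grind
    · rw [Finset.disjoint_left]
      grind
    · rw [Finset.disjoint_left]
      intro z hz hzA
      rcases Finset.mem_union.1 hz with hz | hz
      · exact hdT' hz (hAT hzA)
      · rcases Finset.mem_insert.1 hz with rfl | hz
        · exact hwA hzA
        · exact (hAB z hzA z hz).1 rfl

/-- A component touching only one root splits trivially at a neighbour of that root. -/
lemma exists_split_of_not_adj (h : Rooted G W u v T) (hDT : D ⊆ T)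
    (hDcl : ∀ x ∈ D, ∀ y ∈ T, G.Adj x y → y ∈ D) (hDu : ∃ x ∈ D, G.Adj u x)
    (hDv : ∀ x ∈ D, ¬ G.Adj v x) : ∃ w ∈ D, Rooted G W u w (D.erase w) := by
  obtain ⟨w, hw, huw⟩ := hDu
  refine ⟨w, hw, of_adj (fun x hx => h.subset (hDT (by grind))) h.left_mem
    (h.subset (hDT hw)) (fun hu => h.left_notMem (hDT (by grind))) (by grind) huw ?_⟩
  intro x hx y hy hxy
  have hxD : x ∈ D := by grind
  have hyx := hxy.symm
  have := hDcl x hxD y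
  have hDv' := hDv x hxD
  rcases h.closed x (hDT hxD) y hy hxy with hc | rfl | rfl
  · have := this hc hxy
    grind
  · exact Or.inr (Or.inl rfl)
  · exact absurd hyx hDv'

/-- Every component of `T` has a vertex `w` that separates the two roots in it. -/
lemma exists_split (hG : K4MinorFree G) (h : Rooted G W u v T) (hDT : D ⊆ T)
    (hDl : Linked G D) (hDcl : ∀ x ∈ D, ∀ y ∈ T, G.Adj x y → y ∈ D)
    (htouch : ∃ x ∈ D, G.Adj u x ∨ G.Adj v x) :
    ∃ w A B, D = insert w (A ∪ B) ∧ w ∉ A ∧ w ∉ B ∧ Disjoint A B ∧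
      (A.Nonempty → Rooted G W u w A) ∧ (B.Nonempty → Rooted G W v w B) := by
  classical
  by_cases hDv : ∀ x ∈ D, ¬ G.Adj v x
  · obtain ⟨w, hw, hr⟩ := h.exists_split_of_not_adj hDT hDcl (by grind) hDv
    exact ⟨w, D.erase w, ∅, by grind, by grind, by grind, by simp, fun _ => hr, by simp⟩
  by_cases hDu : ∀ x ∈ D, ¬ G.Adj u x
  · obtain ⟨w, hw, hr⟩ := h.symm.exists_split_of_not_adj hDT hDcl (by grind) hDu
    exact ⟨w, ∅, D.erase w, by grind, by grind, by grind, by simp, by simp, fun _ => hr⟩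
  push Not at hDv hDu
  have : Nonempty V := ⟨u⟩
  rcases exists_separator_or_disjoint_linked (G := G) (G.Adj v) D (G.Adj u) with
    ⟨w, hw⟩ | ⟨X, hX, Y, hY, hXY, hXl, hYl, hXu, hXv, hYu, hYv⟩
  · have hwD : w ∈ D := by
      by_contra hwD
      obtain ⟨q, hq, hvq⟩ := hDv
      exact hw D subset_rfl hwD hDl hDu q hq hvq
    set A : Finset V := (D.erase w).filter fun x => ∃ C ⊆ D.erase w, Linked G C ∧ x ∈ C ∧
      ∃ p ∈ C, G.Adj u p with hA
    have hmem : ∀ x, x ∈ A ↔ x ∈ D.erase w ∧ ∃ C ⊆ D.erase w, Linked G C ∧ x ∈ C ∧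
        ∃ p ∈ C, G.Adj u p := by
      intro x
      rw [hA, Finset.mem_filter]
    have hAD : A ⊆ D.erase w := Finset.filter_subset _ _
    have hAv : ∀ x ∈ A, ¬ G.Adj v x := by
      intro x hx
      obtain ⟨-, C, hC, hCl, hxC, hCu⟩ := (hmem x).1 hx
      exact hw C (by grind) (by grind) hCl hCu x hxC
    have hBu : ∀ x ∈ D.erase w \ A, ¬ G.Adj u x := by
      intro x hx hux
      rw [Finset.mem_sdiff] at hx
      exact hx.2 ((hmem x).2 ⟨hx.1, {x}, by simpa using hx.1, Linked.singleton x, by simp, x,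
        by simp, hux⟩)
    have hAB : ∀ x ∈ A, ∀ y ∈ D.erase w \ A, x ≠ y ∧ ¬ G.Adj x y := by
      intro x hx y hy
      rw [Finset.mem_sdiff] at hy
      refine ⟨fun hxy => hy.2 (hxy ▸ hx), fun hxy => hy.2 ((hmem y).2 ⟨hy.1, ?_⟩)⟩
      obtain ⟨-, C, hC, hCl, hxC, p, hp, hup⟩ := (hmem x).1 hx
      exact ⟨insert y C, Finset.insert_subset hy.1 hC, hCl.insert_adj ⟨x, hxC, hxy.symm⟩, by simp,
        p, by simp [hp], hup⟩
    have hD : D = insert w (A ∪ (D.erase w \ A)) := by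
      rw [Finset.union_sdiff_of_subset hAD, Finset.insert_erase hwD]
    have hD' : D = insert w ((D.erase w \ A) ∪ A) := by
      rw [Finset.union_comm, ← hD]
    have hwA : w ∉ A := fun hwA => Finset.notMem_erase w D (hAD hwA)
    have hwB : w ∉ D.erase w \ A := by simp
    refine ⟨w, A, D.erase w \ A, hD, hwA, hwB, Finset.disjoint_sdiff, fun _ => ?_, fun _ => ?_⟩
    · refine h.of_cut (B := D.erase w \ A) (hD ▸ hDT) (hD ▸ hDcl) (hD ▸ hDl) hwA hAB hAv ?_
      obtain ⟨q, hq, hvq⟩ := hDv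
      exact ⟨q, by grind, hvq⟩
    · refine h.symm.of_cut (B := A) (hD' ▸ hDT) (hD' ▸ hDcl) (hD' ▸ hDl) hwB
        (fun x hx y hy => ⟨fun hxy => (hAB y hy x hx).1 hxy.symm,
          fun hxy => (hAB y hy x hx).2 hxy.symm⟩) hBu ?_
      obtain ⟨q, hq, huq⟩ := hDu
      exact ⟨q, by grind, huq⟩
  · obtain ⟨q, hq, hvq⟩ := hXv
    obtain ⟨p, hp, hup⟩ := hXu
    obtain ⟨X', hX', hXX', hd, hXl', hadj⟩ := hDl.exists_adjacent_superset hX hY hXY hXl ⟨q, hq⟩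
      (hYu.imp fun _ h => h.1)
    exact absurd (h.hasCliqueMinor (hX'.trans hDT) (hY.trans hDT) hd hXl' hYl
      ⟨p, hXX' hp, hup⟩ ⟨q, hXX' hq, hvq⟩ hYu hYv hadj) hG

end Rooted

section LargeOnePage

variable {V : Type} {G : SimpleGraph V} [DecidableEq V]

/-- A one-page set may be enlarged by `T` if every component of `T` is attached to it at one
vertex at most. -/
lemma OnePage.union_components {S T : Finset V} (hS : OnePage G S) (hST : Disjoint S T)
    (hcomp : ∀ D ⊆ T, D.Nonempty → Linked G D → (∀ x ∈ D, ∀ y ∈ T, G.Adj x y → y ∈ D) →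
      ∃ c, OnePage G (insert c D) ∧ ∀ x ∈ D, ∀ y ∈ S, G.Adj x y → y = c) :
    OnePage G (S ∪ T) := by
  rw [Finset.disjoint_left] at hST
  have key : ∀ T' ⊆ T, (∀ x ∈ T', ∀ y ∈ T, G.Adj x y → y ∈ T') → OnePage G (S ∪ T') := by
    intro T'
    induction T' using Finset.strongInduction with
    | H T' ih =>
    intro hT' hcl
    rcases T'.eq_empty_or_nonempty with rfl | ⟨x, hx⟩
    · simpa using hS
    obtain ⟨D, hD, hxD, hDl, hDcl⟩ := exists_component G hx
    have hDcl' : ∀ x ∈ D, ∀ y ∈ T, G.Adj x y → y ∈ D := fun x hx y hy hxy =>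
      hDcl x hx y (hcl x (hD hx) y hy hxy) hxy
    have hrest : OnePage G (S ∪ T' \ D) := by
      refine ih (T' \ D) (Finset.sdiff_ssubset hD ⟨x, hxD⟩) (Finset.sdiff_subset.trans hT') ?_
      intro y hy z hz hyz
      have := hDcl z
      have := hcl y
      have := hyz.symm
      grind
    obtain ⟨c, hc, hcS⟩ := hcomp D (hD.trans hT') ⟨x, hxD⟩ hDl hDcl'
    have hunion : S ∪ T' = S ∪ T' \ D ∪ D := by
      rw [Finset.union_assoc, Finset.sdiff_union_of_subset hD]
    rw [hunion]
    refine hrest.attach hc ?_ ?_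
    · rw [Finset.disjoint_left]
      grind
    · intro y hy z hz hyz
      have := hDcl y hy z
      grind
  exact key T subset_rfl fun _ _ y hy _ => hy

/-- In a minimal large rooted set, a component either can be removed at the cost of one of its at
least five vertices, or is small and remains one-page together with one of the roots. -/
lemma Rooted.component_cases (hG : K4MinorFree G) {W T D : Finset V} {u v : V}
    (h : Rooted G W u v T)
    (hmin : ∀ u' v' T', Rooted G W u' v' T' → T'.card < T.card → T'.card ≤ 3) (hDT : D ⊆ T)
    (hDl : Linked G D) (hDcl : ∀ x ∈ D, ∀ y ∈ T, G.Adj x y → y ∈ D)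
    (htouch : ∃ x ∈ D, G.Adj u x ∨ G.Adj v x) :
    (∃ w ∈ D, 5 ≤ D.card ∧ ∀ S ⊆ W \ D, OnePage G S → OnePage G (S ∪ D.erase w)) ∨
    (D.card ≤ 4 ∧ (OnePage G (insert u D) ∨ OnePage G (insert v D))) := by
  obtain ⟨w, A, B, hD, hwA, hwB, hAB, hA, hB⟩ := h.exists_split hG hDT hDl hDcl htouch
  have hwT : w ∈ T := hDT (by grind)
  have hAT : A ⊆ T := fun x hx => hDT (by grind)
  have hBT : B ⊆ T := fun x hx => hDT (by grind)
  have small : ∀ z A, A ⊆ T → w ∉ A → (A.Nonempty → Rooted G W z w A) → A.card ≤ 3 := by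
    intro z A hAT hwA hA
    rcases A.eq_empty_or_nonempty with rfl | hne
    · simp
    · exact hmin _ _ _ (hA hne)
        (Finset.card_lt_card (Finset.ssubset_iff_subset_ne.2 ⟨hAT, fun h => hwA (h ▸ hwT)⟩))
  have hA3 := small u A hAT hwA hA
  have hB3 := small v B hBT hwB hB
  have hAcl : ∀ x ∈ A, ∀ y ∈ W, G.Adj x y → y ∈ A ∨ y = u ∨ y = w := fun x hx =>
    (hA ⟨x, hx⟩).closed x hx
  have hBcl : ∀ x ∈ B, ∀ y ∈ W, G.Adj x y → y ∈ B ∨ y = v ∨ y = w := fun x hx =>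
    (hB ⟨x, hx⟩).closed x hx
  have hcard : D.card = A.card + B.card + 1 := by
    rw [hD, Finset.card_insert_of_notMem (by grind), Finset.card_union_of_disjoint hAB]
  have one : ∀ {X : Finset V} (z : V), X.card ≤ 3 → OnePage G (insert z X) := fun z hX =>
    onePage_of_card_le_four hG ((Finset.card_insert_le _ _).trans (by omega))
  have huT := h.left_notMem
  have hvT := h.right_notMem
  have huv := h.ne
  have hTW := h.subset
  rw [Finset.disjoint_left] at hAB
  by_cases hbig : 4 ≤ A.card + B.card
  · refine Or.inl ⟨w, by grind, by omega, fun S hS hSp => ?_⟩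
    have hunion : S ∪ D.erase w = S ∪ A ∪ B := by grind
    rw [hunion]
    have hSA : OnePage G (S ∪ A) := by
      refine hSp.attach (one u hA3) ?_ ?_
      · rw [Finset.disjoint_left]
        grind
      · intro x hx y hy hxy
        have := hAcl x hx y
        grind
    refine hSA.attach (one v hB3) ?_ ?_
    · rw [Finset.disjoint_left]
      grind
    · intro x hx y hy hxy
      have := hBcl x hx y
      grind
  · refine Or.inr ⟨by omega, ?_⟩
    rcases le_total A.card 2 with hA2 | hA2
    · left
      have hunion : insert u D = insert u (insert w A) ∪ B := by grind
      rw [hunion]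
      refine (one u ((Finset.card_insert_le _ _).trans (by omega))).attach (one w hB3) ?_ ?_
      · rw [Finset.disjoint_left]
        grind
      · intro x hx y hy hxy
        have := hBcl x hx y
        have := h.left_mem
        grind
    · right
      have hunion : insert v D = insert v (insert w B) ∪ A := by grind
      rw [hunion]
      refine (one v ((Finset.card_insert_le _ _).trans (by omega))).attach (one w hA3) ?_ ?_
      · rw [Finset.disjoint_left]
        grind
      · intro x hx y hy hxy
        have := hAcl x hx y
        have := h.right_mem
        grind

/-- In a `K₄`-minor-free graph, every finite vertex set has a one-page subset containing at least
four fifths of its vertices. -/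
theorem exists_onePage_subset (hG : K4MinorFree G) (W : Finset V) :
    ∃ S ⊆ W, OnePage G S ∧ 4 * W.card ≤ 5 * S.card := by
  induction W using Finset.strongInduction with
  | H W ih =>
  by_contra hcon
  -- no part `A` of `W` can be removed while keeping four fifths `B` of it
  have not_removable : ∀ A ⊆ W, A.Nonempty → ∀ B ⊆ A, 4 * A.card ≤ 5 * B.card →
      (∀ S ⊆ W \ A, OnePage G S → OnePage G (S ∪ B)) → False := by
    intro A hA hne B hB hAB hext
    obtain ⟨S, hS, hSp, hcard⟩ := ih (W \ A) (Finset.sdiff_ssubset hA hne)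
    refine hcon ⟨S ∪ B, by grind, hext S hS hSp, ?_⟩
    have h₁ : (S ∪ B).card = S.card + B.card := by
      rw [Finset.card_union_of_disjoint]
      rw [Finset.disjoint_left]
      grind
    have h₂ := Finset.card_sdiff_add_card_eq_card hA
    omega
  have hbig : 6 ≤ W.card := by
    by_contra hlt
    rcases le_or_gt W.card 4 with h4 | h5
    · exact hcon ⟨W, subset_rfl, onePage_of_card_le_four hG h4, by omega⟩
    · obtain ⟨x, hx⟩ := Finset.card_pos.1 (show 0 < W.card by omega)
      have hcard := Finset.card_erase_of_mem hx
      exact hcon ⟨W.erase x, Finset.erase_subset x W, onePage_of_card_le_four hG (by omega),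
        by omega⟩
  have hconn : Linked G W := by
    intro C hC hne hcl
    by_contra hWC
    have hss : C ⊂ W := ⟨hC, hWC⟩
    obtain ⟨B, hB, hBp, hcard⟩ := ih C hss
    refine not_removable C hC hne B hB hcard fun S hS hSp => hSp.union_of_not_adj hBp ?_
    intro x hx y hy
    refine ⟨by grind, fun hxy => ?_⟩
    have := hcl y (hB hy) x (by grind) hxy.symm
    grind
  -- a rooted set to start from, and a minimal one
  obtain ⟨u, v, T, hT, hT4, hmin⟩ : ∃ u v T, Rooted G W u v T ∧ 4 ≤ T.card ∧
      ∀ u' v' T', Rooted G W u' v' T' → T'.card < T.card → T'.card ≤ 3 := by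
    have hex : ∃ n, ∃ u v T, Rooted G W u v T ∧ 4 ≤ T.card ∧ T.card = n := by
      obtain ⟨u, hu⟩ := Finset.card_pos.1 (show 0 < W.card by omega)
      obtain ⟨z, hz, hzu⟩ := Finset.exists_mem_ne (show 1 < W.card by omega) u
      obtain ⟨x, hx, v, hv, -, huv⟩ := hconn.exists_adj (C := {u}) (by simpa using hu) (by simp)
        ⟨z, hz, by simpa using hzu⟩
      rw [Finset.mem_singleton] at hx
      subst hx
      refine ⟨_, x, v, (W.erase x).erase v, Rooted.of_adj (by grind) hu hv (by grind) (by grind)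
        huv (by grind), ?_, rfl⟩
      have := Finset.pred_card_le_card_erase (s := W) (a := x)
      have := Finset.pred_card_le_card_erase (s := W.erase x) (a := v)
      omega
    classical
    obtain ⟨u, v, T, hT, hT4, hn⟩ := Nat.find_spec hex
    refine ⟨u, v, T, hT, hT4, fun u' v' T' hT' hlt => ?_⟩
    by_contra hT4'
    exact Nat.find_min hex (hn ▸ hlt) ⟨u', v', T', hT', by omega, rfl⟩
  have huT := hT.left_notMem
  have hvT := hT.right_notMem
  have huW := hT.left_mem
  have hvW := hT.right_mem
  have hTW := hT.subset
  have components : ∀ D ⊆ T, D.Nonempty → Linked G D →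
      (∀ x ∈ D, ∀ y ∈ T, G.Adj x y → y ∈ D) →
      D.card ≤ 4 ∧ (OnePage G (insert u D) ∨ OnePage G (insert v D)) := by
    intro D hDT hne hDl hDcl
    have htouch : ∃ x ∈ D, G.Adj u x ∨ G.Adj v x := by
      obtain ⟨x, hx, y, hy, hyD, hxy⟩ := hconn.exists_adj (C := D) (hDT.trans hTW) hne
        ⟨u, huW, fun h => huT (hDT h)⟩
      have := hDcl x hx y
      refine ⟨x, hx, ?_⟩
      rcases hT.closed x (hDT hx) y hy hxy with h | rfl | rfl
      · exact absurd (this h hxy) hyD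
      · exact Or.inl hxy.symm
      · exact Or.inr hxy.symm
    rcases hT.component_cases hG hmin hDT hDl hDcl htouch with ⟨w, hw, hcard, hext⟩ | h
    · have := Finset.card_erase_of_mem hw
      exact (not_removable D (hDT.trans hTW) hne (D.erase w) (Finset.erase_subset w D) (by omega)
        hext).elim
    · exact h
  -- deleting one root `z` fails because of a component of four vertices at the other root
  have obstruction : ∀ z z', z ∈ W → z ∉ T →
      (∀ x ∈ T, ∀ y ∈ W, G.Adj x y → y ∈ T ∨ y = z ∨ y = z') →
      ∃ D ⊆ T, D.Nonempty ∧ Linked G D ∧ (∀ x ∈ D, ∀ y ∈ T, G.Adj x y → y ∈ D) ∧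
        ¬ OnePage G (insert z' D) := by
    intro z z' hzW hzT hcl
    by_contra! hall
    refine not_removable (insert z T) (Finset.insert_subset hzW hTW) (Finset.insert_nonempty _ _) T
      (Finset.subset_insert z T) ?_ fun S hS hSp => ?_
    · rw [Finset.card_insert_of_notMem hzT]
      omega
    · refine hSp.union_components ?_ fun D hDT hne hDl hDcl =>
        ⟨z', hall D hDT hne hDl hDcl, fun x hx y hy hxy => ?_⟩
      · rw [Finset.disjoint_left]
        grind
      · have := hcl x (hDT hx) y
        grind
  have four : ∀ D ⊆ T, ∀ z, ¬ OnePage G (insert z D) → 4 ≤ D.card := by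
    intro D hDT z hz
    by_contra hlt
    exact hz (onePage_of_card_le_four hG ((Finset.card_insert_le _ _).trans (by omega)))
  obtain ⟨D, hDT, hDne, hDl, hDcl, hDv⟩ := obstruction u v huW huT hT.closed
  obtain ⟨D', hDT', hDne', hDl', hDcl', hDu⟩ := obstruction v u hvW hvT hT.symm.closed
  have hdisj : Disjoint D D' := by
    rw [Finset.disjoint_left]
    intro x hx hx'
    have h₁ : D ⊆ D' :=
      (hDl (D ∩ D') Finset.inter_subset_left ⟨x, by grind⟩ (by grind)).trans
        Finset.inter_subset_right
    have h₂ : D' ⊆ D :=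
      (hDl' (D ∩ D') Finset.inter_subset_right ⟨x, by grind⟩ (by grind)).trans
        Finset.inter_subset_left
    obtain rfl := h₁.antisymm h₂
    rcases (components D hDT hDne hDl hDcl).2 with h | h
    · exact hDu h
    · exact hDv h
  have hT8 : 8 ≤ T.card := by
    have h₁ := four D hDT v hDv
    have h₂ := four D' hDT' u hDu
    have h₃ := Finset.card_le_card (Finset.union_subset hDT hDT')
    rw [Finset.card_union_of_disjoint hdisj] at h₃
    omega
  refine not_removable (insert u (insert v T))
    (Finset.insert_subset huW (Finset.insert_subset hvW hTW)) (Finset.insert_nonempty _ _) T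
    ((Finset.subset_insert _ _).trans (Finset.subset_insert _ _)) ?_ fun S hS hSp => ?_
  · have h₁ := Finset.card_insert_le u (insert v T)
    have h₂ := Finset.card_insert_le v T
    omega
  · refine hSp.union_components ?_ fun C hCT hne hCl hCcl => ?_
    · rw [Finset.disjoint_left]
      grind
    · obtain ⟨c, hc⟩ := hne
      refine ⟨c, ?_, fun x hx y hy hxy => ?_⟩
      · rw [Finset.insert_eq_of_mem hc]
        exact onePage_of_card_le_four hG (components C hCT ⟨c, hc⟩ hCl hCcl).1
      · have := hT.closed x (hCT hx) y
        grind

end LargeOnePage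

/-- Every `K₄`-minor-free graph of order `n` has an induced
outerplanar subgraph of order at least `4n/5`. -/
theorem stmt11 (V : Type) [Fintype V] (G : SimpleGraph V) (hG : K4MinorFree G) :
    ∃ S : Finset V, IsOuterplanar (G.induce (↑S : Set V)) ∧
      (4 * (Fintype.card V : ℚ)) / 5 ≤ (S.card : ℚ) := by
  classical
  obtain ⟨S, -, hS, hcard⟩ := exists_onePage_subset hG Finset.univ
  refine ⟨S, hS.isOuterplanar, ?_⟩
  rw [Finset.card_univ] at hcard
  have : (4 * (Fintype.card V : ℚ)) ≤ 5 * (S.card : ℚ) := by exact_mod_cast hcard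
  linarith
end

section
/- A 2-tree G is not a maximal outerplanar graph if and only if G contains a subgraph isomorphic to K_{1,1,3}; equivalently, a 2-tree is outerplanar if and only if it contains no subgraph isomorphic to K_{1,1,3}. -/
open unitInterval in
/-- Two continuous logarithms of the same function on `[0, 1]` have the same total increment. -/
theorem log_increment_unique {L L' : I → ℂ} (hL : Continuous L) (hL' : Continuous L')
    (h : ∀ t, Complex.exp (L t) = Complex.exp (L' t)) : L 1 - L 0 = L' 1 - L' 0 := by
  obtain ⟨n, hn⟩ := Complex.exp_eq_exp_iff_exists_int.1 (h 0)
  have key : L = fun t ↦ L' t + n * (2 * Real.pi * Complex.I) := by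
    refine Complex.isCoveringMap_exp.eq_of_comp_eq hL (by fun_prop) ?_ 0 hn
    funext t
    refine Subtype.ext ?_
    simp only [Function.comp_apply]
    rw [h t]
    exact (Complex.exp_eq_exp_iff_exists_int.2 ⟨n, rfl⟩).symm
  rw [key]
  ring

open unitInterval in
/-- A nonvanishing continuous function on the unit square has a continuous logarithm. -/
theorem exists_log_square (F : C(I × I, ℂ)) (hF : ∀ x, F x ≠ 0) :
    ∃ L : C(I × I, ℂ), ∀ x, Complex.exp (L x) = F x := by
  let H : C(I × I, {z : ℂ // z ≠ 0}) := ⟨fun x ↦ ⟨F x, hF x⟩, by fun_prop⟩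
  have cov := Complex.isCoveringMap_exp
  obtain ⟨f, hf, -⟩ := cov.exists_path_lifts (H.comp ⟨fun t ↦ ((0 : I), t), by fun_prop⟩)
    (Complex.log (F (0, 0))) (Subtype.ext (Complex.exp_log (hF _)).symm)
  have hlift := cov.liftHomotopy_lifts H f fun t ↦ (congrFun hf t).symm
  exact ⟨_, fun x ↦ congrArg Subtype.val (congrFun hlift x)⟩

open unitInterval in
/-- The planar linking relation: for every drawing of a graph in `ℂ` there are integers
`n a b c` (the winding of the edge `a b` around the vertex `c`, corrected by the directions
between the endpoints) which satisfy a linear relation for every pair of disjoint edges.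
Here `s` is the order relation of a linear order of the vertices. -/
theorem exists_winding_integers {ι : Type*} (s : ι → ι → ℤ)
    (hs : ∀ x y, x ≠ y → s x y + s y x = 1) (hs' : ∀ x y, s x y = 0 ∨ s x y = 1)
    (P : ι → ℂ) (γ : ι → ι → C(I, ℂ)) :
    ∃ n : ι → ι → ι → ℤ, ∀ a b c d, a ≠ c → a ≠ d → b ≠ c → b ≠ d →
      γ a b 0 = P a → γ a b 1 = P b → γ c d 0 = P c → γ c d 1 = P d →
      (∀ t u, γ a b t ≠ γ c d u) →
      n a b c + n c d b - n a b d - n c d a + (s b c + s d b + s a d + s c a) = 2 := by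
  have hpi : (2 * Real.pi * Complex.I : ℂ) ≠ 0 := Complex.two_pi_I_ne_zero
  have hlog : ∃ l : ι → ι → ℂ, ∀ x y, P x ≠ P y → x ≠ y → Complex.exp (l x y) = P x - P y ∧
      l x y - l y x = (2 * s x y - 1) * (Real.pi * Complex.I) := by
    refine ⟨fun x y ↦ if s x y = 0 then Complex.log (P x - P y) else
      Complex.log (P y - P x) + Real.pi * Complex.I, fun x y hP hxy ↦ ?_⟩
    have h1 := hs x y hxy
    rcases hs' x y with h | h
    · have h2 : s y x = 1 := by omega
      simp only [h, h2, if_true, one_ne_zero, if_false]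
      refine ⟨Complex.exp_log (sub_ne_zero.2 hP), ?_⟩
      push_cast
      ring
    · have h2 : s y x = 0 := by omega
      simp only [h, h2, if_true, one_ne_zero, if_false]
      refine ⟨?_, ?_⟩
      · rw [Complex.exp_add, Complex.exp_pi_mul_I, Complex.exp_log (sub_ne_zero.2 hP.symm)]
        ring
      · push_cast
        ring
  obtain ⟨l, hl⟩ := hlog
  have hn : ∀ a b c, ∃ n : ℤ, ∀ L : I → ℂ, Continuous L → a ≠ c → b ≠ c →
      γ a b 0 = P a → γ a b 1 = P b → (∀ t, Complex.exp (L t) = γ a b t - P c) →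
      L 1 - L 0 = l b c - l a c + n * (2 * Real.pi * Complex.I) := by
    intro a b c
    by_cases h : ∃ L : I → ℂ, Continuous L ∧ a ≠ c ∧ b ≠ c ∧
      γ a b 0 = P a ∧ γ a b 1 = P b ∧ (∀ t, Complex.exp (L t) = γ a b t - P c)
    · obtain ⟨L, hL, hac, hbc, h0, h1, hexp⟩ := h
      have e0 := hexp 0
      have e1 := hexp 1
      rw [h0] at e0
      rw [h1] at e1
      have n0 : P a ≠ P c := sub_ne_zero.1 (e0 ▸ Complex.exp_ne_zero _)
      have n1 : P b ≠ P c := sub_ne_zero.1 (e1 ▸ Complex.exp_ne_zero _)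
      have : Complex.exp (L 1 - L 0) = Complex.exp (l b c - l a c) := by
        rw [Complex.exp_sub, Complex.exp_sub, e0, e1, (hl a c n0 hac).1, (hl b c n1 hbc).1]
      obtain ⟨n, hn⟩ := Complex.exp_eq_exp_iff_exists_int.1 this
      refine ⟨n, fun L' hL' _ _ _ _ hexp' ↦ ?_⟩
      rw [log_increment_unique hL' hL (fun t ↦ (hexp' t).trans (hexp t).symm), hn]
    · exact ⟨0, fun L hL h1 h2 h3 h4 h5 ↦ (h ⟨L, hL, h1, h2, h3, h4, h5⟩).elim⟩
  choose n hn using hn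
  refine ⟨n, fun a b c d hac had hbc hbd hab0 hab1 hcd0 hcd1 hdisj ↦ ?_⟩
  obtain ⟨L, hL⟩ := exists_log_square ⟨fun x ↦ γ a b x.1 - γ c d x.2, by fun_prop⟩
    (fun x ↦ sub_ne_zero.2 (hdisj _ _))
  simp only [ContinuousMap.coe_mk, Prod.forall] at hL
  have neg : ∀ z w v : ℂ, Complex.exp z = w - v →
      Complex.exp (z + Real.pi * Complex.I) = v - w := by
    intro z w v h
    rw [Complex.exp_add, Complex.exp_pi_mul_I, h]
    ring
  have e1 := hn a b c (fun t ↦ L (t, 0)) (by fun_prop) hac hbc hab0 hab1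
    (fun t ↦ by rw [hL, hcd0])
  have e2 := hn a b d (fun t ↦ L (t, 1)) (by fun_prop) had hbd hab0 hab1
    (fun t ↦ by rw [hL, hcd1])
  have e3 := hn c d a (fun t ↦ L (0, t) + Real.pi * Complex.I) (by fun_prop) hac.symm had.symm
    hcd0 hcd1 (fun t ↦ neg _ _ _ (by rw [hL, hab0]))
  have e4 := hn c d b (fun t ↦ L (1, t) + Real.pi * Complex.I) (by fun_prop) hbc.symm hbd.symm
    hcd0 hcd1 (fun t ↦ neg _ _ _ (by rw [hL, hab1]))
  have P1 : P b ≠ P c := by rw [← hab1, ← hcd0]; exact hdisj _ _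
  have P2 : P d ≠ P b := by rw [← hab1, ← hcd1]; exact (hdisj _ _).symm
  have P3 : P a ≠ P d := by rw [← hab0, ← hcd1]; exact hdisj _ _
  have P4 : P c ≠ P a := by rw [← hab0, ← hcd0]; exact (hdisj _ _).symm
  have f1 := (hl b c P1 hbc).2
  have f2 := (hl d b P2 hbd.symm).2
  have f3 := (hl a d P3 had).2
  have f4 := (hl c a P4 hac.symm).2
  have key : ((n a b c + n c d b - n a b d - n c d a + (s b c + s d b + s a d + s c a) : ℤ) : ℂ)
      * (2 * Real.pi * Complex.I) = (2 : ℤ) * (2 * Real.pi * Complex.I) := by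
    push_cast
    linear_combination e2 + e3 - e1 - e4 - f1 - f2 - f3 - f4
  exact_mod_cast mul_right_cancel₀ hpi key

/-- `exists_winding_integers` for a drawing in `ℝ × ℝ` whose edges are drawn inside given sets. -/
theorem exists_winding_integers_of_joinedIn {ι : Type*} (s : ι → ι → ℤ)
    (hs : ∀ x y, x ≠ y → s x y + s y x = 1) (hs' : ∀ x y, s x y = 0 ∨ s x y = 1)
    (P : ι → ℝ × ℝ) (K : ι → ι → Set (ℝ × ℝ)) :
    ∃ n : ι → ι → ι → ℤ, ∀ a b c d, a ≠ c → a ≠ d → b ≠ c → b ≠ d →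
      JoinedIn (K a b) (P a) (P b) → JoinedIn (K c d) (P c) (P d) → Disjoint (K a b) (K c d) →
      n a b c + n c d b - n a b d - n c d a + (s b c + s d b + s a d + s c a) = 2 := by
  let φ := Complex.equivRealProdCLM.symm
  have hγ : ∀ a b, ∃ γ : C(unitInterval, ℝ × ℝ), JoinedIn (K a b) (P a) (P b) →
      γ 0 = P a ∧ γ 1 = P b ∧ ∀ t, γ t ∈ K a b := by
    intro a b
    by_cases h : JoinedIn (K a b) (P a) (P b)
    · exact ⟨h.somePath, fun _ ↦ ⟨h.somePath.source, h.somePath.target, h.somePath_mem⟩⟩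
    · exact ⟨.const _ 0, fun h' ↦ (h h').elim⟩
  choose γ hγ using hγ
  obtain ⟨n, hn⟩ := exists_winding_integers s hs hs' (φ ∘ P)
    (fun a b ↦ ⟨fun t ↦ φ (γ a b t), by fun_prop⟩)
  refine ⟨n, fun a b c d hac had hbc hbd hab hcd hdisj ↦ hn a b c d hac had hbc hbd ?_ ?_ ?_ ?_ ?_⟩
  · simp [(hγ a b hab).1]
  · simp [(hγ a b hab).2.1]
  · simp [(hγ c d hcd).1]
  · simp [(hγ c d hcd).2.1]
  · intro t u h
    exact Set.disjoint_left.1 hdisj ((hγ a b hab).2.2 t)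
      (φ.injective h ▸ (hγ c d hcd).2.2 u)

/-- `K₅` has no drawing in the plane in which edges without a common endpoint are disjoint. -/
theorem not_drawing_K5 (P : Fin 5 → ℝ × ℝ) (K : Fin 5 → Fin 5 → Set (ℝ × ℝ))
    (hK : ∀ a b, a < b → JoinedIn (K a b) (P a) (P b))
    (hdisj : ∀ a b c d, a < b → c < d → a < c → b ≠ c → b ≠ d →
      Disjoint (K a b) (K c d)) : False := by
  obtain ⟨n, hn⟩ := exists_winding_integers_of_joinedIn (fun x y : Fin 5 ↦ if y < x then 1 else 0)
    (by decide) (by decide) P K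
  have h : ∀ a b c d, a < b → c < d → a < c → b ≠ c → b ≠ d → _ := fun a b c d hab hcd hac hbc hbd ↦
    hn a b c d hac.ne (hac.trans hcd).ne hbc hbd (hK a b hab) (hK c d hcd)
      (hdisj a b c d hab hcd hac hbc hbd)
  have e1 := h 0 1 2 3 (by decide) (by decide) (by decide) (by decide) (by decide)
  have e2 := h 0 2 1 3 (by decide) (by decide) (by decide) (by decide) (by decide)
  have e3 := h 0 3 1 2 (by decide) (by decide) (by decide) (by decide) (by decide)
  have e4 := h 0 1 2 4 (by decide) (by decide) (by decide) (by decide) (by decide)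
  have e5 := h 0 2 1 4 (by decide) (by decide) (by decide) (by decide) (by decide)
  have e6 := h 0 4 1 2 (by decide) (by decide) (by decide) (by decide) (by decide)
  have e7 := h 0 1 3 4 (by decide) (by decide) (by decide) (by decide) (by decide)
  have e8 := h 0 3 1 4 (by decide) (by decide) (by decide) (by decide) (by decide)
  have e9 := h 0 4 1 3 (by decide) (by decide) (by decide) (by decide) (by decide)
  have e10 := h 0 2 3 4 (by decide) (by decide) (by decide) (by decide) (by decide)
  have e11 := h 0 3 2 4 (by decide) (by decide) (by decide) (by decide) (by decide)
  have e12 := h 0 4 2 3 (by decide) (by decide) (by decide) (by decide) (by decide)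
  have e13 := h 1 2 3 4 (by decide) (by decide) (by decide) (by decide) (by decide)
  have e14 := h 1 3 2 4 (by decide) (by decide) (by decide) (by decide) (by decide)
  have e15 := h 1 4 2 3 (by decide) (by decide) (by decide) (by decide) (by decide)
  simp +decide only [if_true, if_false] at e1 e2 e3 e4 e5 e6 e7 e8 e9 e10 e11 e12 e13 e14 e15
  omega

/-- `K₃,₃` has no drawing in the plane in which edges without a common endpoint are disjoint. -/
theorem not_drawing_K33 (P Q : Fin 3 → ℝ × ℝ) (K : Fin 3 → Fin 3 → Set (ℝ × ℝ))
    (hK : ∀ i j, JoinedIn (K i j) (P i) (Q j))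
    (hdisj : ∀ i j k l, i < k → j ≠ l → Disjoint (K i j) (K k l)) : False := by
  obtain ⟨n, hn⟩ := exists_winding_integers_of_joinedIn
    (fun x y : Fin 3 ⊕ Fin 3 ↦ if toLex y < toLex x then 1 else 0)
    (by decide) (by decide) (Sum.elim P Q)
    (Sum.elim (fun i ↦ Sum.elim (fun _ ↦ ∅) (K i)) fun _ _ ↦ ∅)
  have h : ∀ i j k l, i < k → j ≠ l → _ := fun i j k l hik hjl ↦
    hn (.inl i) (.inr j) (.inl k) (.inr l) (by simpa using hik.ne) (by simp) (by simp)
      (by simpa using hjl) (hK i j) (hK k l) (hdisj i j k l hik hjl)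
  have h01 := fun j l ↦ h 0 j 1 l (by decide)
  have h02 := fun j l ↦ h 0 j 2 l (by decide)
  have h12 := fun j l ↦ h 1 j 2 l (by decide)
  have a1 := h01 0 1 (by decide)
  have a2 := h01 0 2 (by decide)
  have a3 := h01 1 0 (by decide)
  have a4 := h01 1 2 (by decide)
  have a5 := h01 2 0 (by decide)
  have a6 := h01 2 1 (by decide)
  have b1 := h02 0 1 (by decide)
  have b2 := h02 0 2 (by decide)
  have b3 := h02 1 0 (by decide)
  have b4 := h02 1 2 (by decide)
  have b5 := h02 2 0 (by decide)
  have b6 := h02 2 1 (by decide)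
  have c1 := h12 0 1 (by decide)
  have c2 := h12 0 2 (by decide)
  have c3 := h12 1 0 (by decide)
  have c4 := h12 1 2 (by decide)
  have c5 := h12 2 0 (by decide)
  have c6 := h12 2 1 (by decide)
  simp +decide only [if_true, if_false] at a1 a2 a3 a4 a5 a6 b1 b2 b3 b4 b5 b6 c1 c2 c3 c4 c5 c6
  omega

namespace PlaneEmbedding

variable {V : Type} {G : SimpleGraph V}

theorem isCompact_arc (E : PlaneEmbedding G) {u v : V} (h : G.Adj u v) :
    IsCompact (E.arc h) := by
  obtain ⟨γ, -, hγ⟩ := E.arc_path h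
  rw [← hγ]
  exact isCompact_range γ.continuous

theorem isCompact_subSupport [Finite V] (E : PlaneEmbedding G) (S : Set V) :
    IsCompact (E.subSupport S) := by
  refine ((Set.toFinite S).image _).isCompact.union ?_
  refine isCompact_iUnion fun u ↦ isCompact_iUnion fun _ ↦ isCompact_iUnion fun v ↦
    isCompact_iUnion fun _ ↦ isCompact_iUnion fun h ↦ E.isCompact_arc h

theorem mem_subSupport {E : PlaneEmbedding G} {S : Set V} {p : ℝ × ℝ} :
    p ∈ E.subSupport S ↔ (∃ v ∈ S, E.vtx v = p) ∨
      ∃ u ∈ S, ∃ v ∈ S, ∃ h : G.Adj u v, p ∈ E.arc h := by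
  simp [subSupport]

theorem vtx_mem_subSupport (E : PlaneEmbedding G) {S : Set V} {v : V} (hv : v ∈ S) :
    E.vtx v ∈ E.subSupport S :=
  mem_subSupport.2 (.inl ⟨v, hv, rfl⟩)

theorem arc_subset_subSupport (E : PlaneEmbedding G) {S : Set V} {u v : V} (hu : u ∈ S)
    (hv : v ∈ S) (h : G.Adj u v) : E.arc h ⊆ E.subSupport S :=
  fun _ hp ↦ mem_subSupport.2 (.inr ⟨u, hu, v, hv, h, hp⟩)

/-- Vertex-disjoint subgraphs have disjoint drawings. -/
theorem disjoint_subSupport (E : PlaneEmbedding G) {S T : Set V} (hST : Disjoint S T) :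
    Disjoint (E.subSupport S) (E.subSupport T) := by
  have hne : ∀ {u v}, u ∈ S → v ∈ T → u ≠ v := fun hu hv ↦ hST.ne_of_mem hu hv
  refine Set.disjoint_left.2 fun p hS hT ↦ ?_
  rcases mem_subSupport.1 hS with ⟨w, hw, rfl⟩ | ⟨u, hu, v, hv, h, hp⟩ <;>
    rcases mem_subSupport.1 hT with ⟨w', hw', h'⟩ | ⟨u', hu', v', hv', h', hp'⟩
  · exact hne hw hw' (E.vtx_inj h'.symm)
  · rcases E.arc_vtx h' w hp' with rfl | rfl
    · exact hne hw hu' rfl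
    · exact hne hw hv' rfl
  · subst h'
    rcases E.arc_vtx h w' hp with rfl | rfl
    · exact hne hu hw' rfl
    · exact hne hv hw' rfl
  · have hs : s(u, v) ≠ s(u', v') := by
      intro hs
      rcases Sym2.eq_iff.1 hs with ⟨h1, -⟩ | ⟨h1, -⟩
      · exact hne hu hu' h1
      · exact hne hu hv' h1
    obtain ⟨h1, h2⟩ := E.arc_inter h h' hs ⟨hp, hp'⟩
    rcases h1 with h1 | h1 <;> rcases h2 with h2 | h2 <;> have h3 := E.vtx_inj (h1.symm.trans h2)
    · exact hne hu hu' h3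
    · exact hne hu hv' h3
    · exact hne hv hu' h3
    · exact hne hv hv' h3

theorem joinedIn_subSupport_of_adj (E : PlaneEmbedding G) {S : Set V} {u v : V} (hu : u ∈ S)
    (hv : v ∈ S) (h : G.Adj u v) : JoinedIn (E.subSupport S) (E.vtx u) (E.vtx v) := by
  obtain ⟨γ, -, hγ⟩ := E.arc_path h
  exact ⟨γ, fun t ↦ E.arc_subset_subSupport hu hv h (hγ ▸ Set.mem_range_self t)⟩

theorem joinedIn_subSupport (E : PlaneEmbedding G) {S : Set V} {u v : S}
    (h : (G.induce S).Reachable u v) : JoinedIn (E.subSupport S) (E.vtx u) (E.vtx v) := by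
  obtain ⟨w⟩ := h
  induction w with
  | nil => exact .refl (E.vtx_mem_subSupport (Subtype.prop _))
  | cons hadj _ ih => exact (E.joinedIn_subSupport_of_adj (Subtype.prop _) (Subtype.prop _)
      (SimpleGraph.induce_adj.1 hadj)).trans ih

theorem isPathConnected_compl_closedBall {R : ℝ} (hR : 0 < R) :
    IsPathConnected (Metric.closedBall (0 : ℝ × ℝ) R)ᶜ := by
  have h0 : IsPathConnected ({0}ᶜ : Set (ℝ × ℝ)) :=
    isPathConnected_compl_singleton_of_one_lt_rank (by simp [one_add_one_eq_two]) 0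
  have himage : (fun x : ℝ × ℝ ↦ (1 + R / ‖x‖) • x) '' {0}ᶜ = (Metric.closedBall 0 R)ᶜ := by
    ext y
    simp only [Set.mem_image, Set.mem_compl_iff, Set.mem_singleton_iff, mem_closedBall_zero_iff,
      not_le]
    constructor
    · rintro ⟨x, hx, rfl⟩
      have hx' : 0 < ‖x‖ := norm_pos_iff.2 hx
      rw [norm_smul, Real.norm_of_nonneg (by positivity)]
      field_simp
      linarith
    · intro hy
      have hy' : 0 < ‖y‖ := hR.trans hy
      have hc : 0 < 1 - R / ‖y‖ := by rw [sub_pos, div_lt_one hy']; exact hy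
      refine ⟨(1 - R / ‖y‖) • y, ?_, ?_⟩
      · exact smul_ne_zero hc.ne' (norm_pos_iff.1 hy')
      · rw [norm_smul, Real.norm_of_nonneg hc.le, smul_smul]
        have : (1 + R / ((1 - R / ‖y‖) * ‖y‖)) * (1 - R / ‖y‖) = 1 := by
          have : ‖y‖ - R ≠ 0 := (sub_pos.2 hy).ne'
          field_simp
          ring
        rw [this, one_smul]
  rw [← himage]
  refine h0.image' ?_
  refine ContinuousOn.smul (continuousOn_const.add (continuousOn_const.div
    continuous_norm.continuousOn fun x hx ↦ norm_ne_zero_iff.2 hx)) continuousOn_id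

/-- In an outerplane drawing a new vertex can be joined to all vertices, by curves which avoid
every subgraph not containing the endpoint. -/
theorem IsOuterplane.exists_apex [Finite V] {E : PlaneEmbedding G} (hE : E.IsOuterplane) :
    ∃ z : ℝ × ℝ, ∀ v, ∃ K : Set (ℝ × ℝ), JoinedIn K z (E.vtx v) ∧
      ∀ S, v ∉ S → Disjoint K (E.subSupport S) := by
  have hcpt := E.isCompact_subSupport Set.univ
  obtain ⟨R, hR, hsub⟩ := hcpt.isBounded.subset_closedBall_lt 0 0
  have hfar := isPathConnected_compl_closedBall hR
  obtain ⟨z, hz⟩ := hfar.nonempty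
  have hcompl : (Metric.closedBall 0 R)ᶜ ⊆ (E.subSupport Set.univ)ᶜ :=
    Set.compl_subset_compl.2 hsub
  have hopen : IsOpen (E.subSupport Set.univ)ᶜ := hcpt.isClosed.isOpen_compl
  have hmono : ∀ {S T : Set V}, S ⊆ T → E.subSupport S ⊆ E.subSupport T := by
    intro S T hST p hp
    rcases mem_subSupport.1 hp with ⟨w, hw, rfl⟩ | ⟨u, hu, v, hv, h, hp⟩
    · exact E.vtx_mem_subSupport (hST hw)
    · exact E.arc_subset_subSupport (hST hu) (hST hv) h hp
  refine ⟨z, fun v ↦ ?_⟩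
  have hv : E.vtx v ∈ (E.subSupport {v}ᶜ)ᶜ := fun hv ↦ Set.disjoint_left.1
    (E.disjoint_subSupport (S := {v}) disjoint_compl_right) (E.vtx_mem_subSupport rfl) hv
  obtain ⟨δ, hδ, hball⟩ := Metric.isOpen_iff.1
    (E.isCompact_subSupport {v}ᶜ).isClosed.isOpen_compl _ hv
  refine ⟨(E.subSupport Set.univ)ᶜ ∪ Metric.ball (E.vtx v) δ, ?_, ?_⟩
  · obtain ⟨p, ⟨hp, hunb⟩, hpv⟩ := Metric.mem_closure_iff.1 (hE v (Set.mem_univ v)) δ hδ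
    have hC : IsPathConnected (connectedComponentIn (E.subSupport Set.univ)ᶜ p) :=
      hopen.connectedComponentIn.isConnected_iff_isPathConnected.1
        (isConnected_connectedComponentIn_iff.2 hp)
    obtain ⟨q, hq, hqR⟩ : ∃ q ∈ connectedComponentIn (E.subSupport Set.univ)ᶜ p,
        q ∉ Metric.closedBall 0 R := by
      by_contra! hcon
      exact hunb (Metric.isBounded_closedBall.subset hcon)
    have h1 : JoinedIn (E.subSupport Set.univ)ᶜ z q := (hfar.joinedIn z hz q hqR).mono hcompl
    have h2 : JoinedIn (E.subSupport Set.univ)ᶜ q p :=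
      (hC.joinedIn q hq p (mem_connectedComponentIn hp)).mono (connectedComponentIn_subset _ _)
    have h3 : JoinedIn (Metric.ball (E.vtx v) δ) p (E.vtx v) :=
      ((convex_ball _ _).isPathConnected ⟨_, Metric.mem_ball_self hδ⟩).joinedIn _
        (by rwa [Metric.mem_ball, dist_comm]) _ (Metric.mem_ball_self hδ)
    exact ((h1.trans h2).mono Set.subset_union_left).trans (h3.mono Set.subset_union_right)
  · intro S hvS
    refine Set.disjoint_union_left.2 ⟨?_, ?_⟩
    · exact (disjoint_compl_left (a := E.subSupport Set.univ)).mono_right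
        (hmono (Set.subset_univ S))
    · refine Set.disjoint_left.2 fun p hp hpS ↦ hball hp (hmono ?_ hpS)
      exact fun w hw hwv ↦ hvS (hwv ▸ hw)

end PlaneEmbedding

/-- An outerplanar graph has no two vertices with three common neighbours. -/
theorem IsOuterplanar.not_containsCopy_K113 {V : Type} [Finite V] {G : SimpleGraph V}
    (hG : IsOuterplanar G) : ¬ ContainsCopy K113 G := by
  rintro ⟨f, hf⟩
  obtain ⟨E, hE⟩ := hG
  obtain ⟨z, hz⟩ := hE.exists_apex
  choose K hKj hKd using hz
  let A : Fin 2 → V := ![f 0, f 1]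
  let C : Fin 3 → V := ![f 2, f 3, f 4]
  have hadj : ∀ i j, G.Adj (A i) (C j) := by
    have h : ∀ a b : Fin 5, K113.Adj a b → G.Adj (f a) (f b) := fun a b ↦ f.map_adj
    intro i j
    fin_cases i <;> fin_cases j <;> exact h _ _ (by simp [K113])
  have hA : Function.Injective A := by
    intro i j h
    fin_cases i <;> fin_cases j <;> simp_all [A, hf.eq_iff]
  have hC : Function.Injective C := by
    intro i j h
    fin_cases i <;> fin_cases j <;> simp_all [C, hf.eq_iff]
  refine not_drawing_K33 (Fin.cons z (fun i ↦ E.vtx (A i))) (fun j ↦ E.vtx (C j))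
    (Fin.cons (fun j ↦ K (C j)) (fun i j ↦ E.subSupport {A i, C j})) ?_ ?_
  · intro i j
    induction i using Fin.cases with
    | zero => simpa using hKj (C j)
    | succ i => simpa using E.joinedIn_subSupport_of_adj (by simp) (by simp) (hadj i j)
  · intro i j k l hik hjl
    induction k using Fin.cases with
    | zero => exact absurd hik (by simp)
    | succ k =>
      have hCjl : C j ≠ C l := hC.ne hjl
      induction i using Fin.cases with
      | zero =>
        simp only [Fin.cons_zero, Fin.cons_succ]
        refine hKd _ _ ?_
        simp [hCjl, (hadj k j).ne']
      | succ i =>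
        simp only [Fin.cons_succ]
        refine E.disjoint_subSupport ?_
        have hik' : A i ≠ A k := hA.ne (by simpa using hik.ne)
        simp [hCjl.symm, hik'.symm, (hadj k j).ne, (hadj i l).ne']

/-- A graph is not outerplanar if it has adjacent vertices `u v`, adjacent vertices `x y`, and
paths from `u` and from `v` to both `x` and `y` forming a subdivision of `K₄`. -/
theorem not_isOuterplanar_of_subdivision_K4 {V : Type} [Finite V] {G : SimpleGraph V}
    {u v x y : V} (huv : G.Adj u v) (hxy : G.Adj x y) (hux : G.Adj u x) (huy : G.Adj u y)
    {S T : Set V} (hvS : v ∈ S) (hvT : v ∈ T) (hxS : x ∈ S) (hyT : y ∈ T)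
    (hS : (G.induce S).Reachable ⟨v, hvS⟩ ⟨x, hxS⟩) (hT : (G.induce T).Reachable ⟨v, hvT⟩ ⟨y, hyT⟩)
    (huS : u ∉ S) (huT : u ∉ T) (hyS : y ∉ S) (hxT : x ∉ T) : ¬ IsOuterplanar G := by
  rintro ⟨E, hE⟩
  obtain ⟨z, hz⟩ := hE.exists_apex
  choose K hKj hKd using hz
  have hvx : v ≠ x := fun h ↦ hxT (h ▸ hvT)
  have hvy : v ≠ y := fun h ↦ hyS (h ▸ hvS)
  refine not_drawing_K5 ![z, E.vtx u, E.vtx v, E.vtx x, E.vtx y]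
    ![![∅, K u, K v, K x, K y],
      ![∅, ∅, E.subSupport {u, v}, E.subSupport {u, x}, E.subSupport {u, y}],
      ![∅, ∅, ∅, E.subSupport S, E.subSupport T],
      ![∅, ∅, ∅, ∅, E.subSupport {x, y}], fun _ ↦ ∅] ?_ ?_
  · intro a b hab
    fin_cases a <;> fin_cases b <;> first | exact absurd hab (by decide) | skip
    · exact hKj u
    · exact hKj v
    · exact hKj x
    · exact hKj y
    · exact E.joinedIn_subSupport_of_adj (by simp) (by simp) huv
    · exact E.joinedIn_subSupport_of_adj (by simp) (by simp) hux
    · exact E.joinedIn_subSupport_of_adj (by simp) (by simp) huy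
    · exact E.joinedIn_subSupport hS
    · exact E.joinedIn_subSupport hT
    · exact E.joinedIn_subSupport_of_adj (by simp) (by simp) hxy
  · have h1 : Disjoint (E.subSupport {u, v}) (E.subSupport {x, y}) := E.disjoint_subSupport (by
      simp [hux.ne', huy.ne', hvx.symm, hvy.symm])
    have h2 : Disjoint (E.subSupport {u, x}) (E.subSupport T) := E.disjoint_subSupport (by
      simp [huT, hxT])
    have h3 : Disjoint (E.subSupport {u, y}) (E.subSupport S) := E.disjoint_subSupport (by
      simp [huS, hyS])
    intro a b c d hab hcd hac hbc hbd
    fin_cases a <;> fin_cases b <;> first | exact absurd hab (by decide) | skip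
    all_goals
      fin_cases c <;> first | exact absurd hac (by decide) | exact absurd rfl hbc | skip
    all_goals
      fin_cases d <;> first | exact absurd hcd (by decide) | exact absurd rfl hbd | skip
    all_goals first
      | exact h1
      | exact h2
      | exact h3
      | exact hKd _ _ huS
      | exact hKd _ _ huT
      | exact hKd _ _ hyS
      | exact hKd _ _ hxT
      | exact hKd _ _ (by simp [hux.ne, huy.ne, hvx, hvy, hxy.ne, huv.ne', hux.ne',
          huy.ne', hvx.symm, hvy.symm, hxy.ne'])

/-- A point of the chord of the parabola `y = x ^ 2` over `[a, b]`. -/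
theorem mem_segment_parabola {a b : ℝ} (hab : a < b) {z : ℝ × ℝ}
    (hz : z ∈ segment ℝ (a, a ^ 2) (b, b ^ 2)) :
    a ≤ z.1 ∧ z.1 ≤ b ∧ z.2 - z.1 ^ 2 = (z.1 - a) * (b - z.1) := by
  obtain ⟨s, t, hs, ht, hst, rfl⟩ := hz
  obtain rfl : s = 1 - t := by linarith
  simp only [Prod.smul_mk, Prod.mk_add_mk, smul_eq_mul]
  refine ⟨?_, ?_, by ring⟩ <;> nlinarith

/-- Two different non-crossing chords of the parabola meet only in common endpoints. -/
theorem segment_parabola_inter {a b c d : ℝ} (hab : a < b) (hcd : c < d)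
    (hne : ¬ (a = c ∧ b = d)) (h₁ : ¬ (a < c ∧ c < b ∧ b < d)) (h₂ : ¬ (c < a ∧ a < d ∧ d < b))
    {z : ℝ × ℝ} (hz : z ∈ segment ℝ (a, a ^ 2) (b, b ^ 2))
    (hz' : z ∈ segment ℝ (c, c ^ 2) (d, d ^ 2)) :
    z.2 = z.1 ^ 2 ∧ (z.1 = a ∨ z.1 = b) ∧ (z.1 = c ∨ z.1 = d) := by
  obtain ⟨h1, h2, h3⟩ := mem_segment_parabola hab hz
  obtain ⟨h4, h5, h6⟩ := mem_segment_parabola hcd hz'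
  have key : (z.1 = a ∨ z.1 = b) ∧ (z.1 = c ∨ z.1 = d) := by
    generalize z.1 = x at *
    have e : (x - a) * (b - x) = (x - c) * (d - x) := h3 ▸ h6
    have nested : ∀ {a b c d : ℝ}, ¬ (a = c ∧ b = d) → a ≤ c → d ≤ b → c ≤ x → x ≤ d →
        (x - a) * (b - x) = (x - c) * (d - x) → (x = a ∨ x = b) ∧ (x = c ∨ x = d) := by
      intro a b c d hne hac hdb hcx hxd e
      rcases hac.lt_or_eq with hac' | rfl
      · have : b - x ≤ 0 := by nlinarith
        have hxb : x = b := by linarith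
        exact ⟨.inr hxb, .inr (by linarith)⟩
      · have hdb' : d < b := lt_of_le_of_ne hdb fun h ↦ hne ⟨rfl, h.symm⟩
        have : x - a ≤ 0 := by nlinarith
        exact ⟨.inl (by linarith), .inl (by linarith)⟩
    rcases le_total a c with hac | hac
    · rcases le_total d b with hdb | hdb
      · exact nested hne hac hdb h4 h5 e
      · rcases hac.lt_or_eq with hac' | rfl
        · rcases hdb.lt_or_eq with hdb' | rfl
          · have : b ≤ c := by
              by_contra! hcb
              exact h₁ ⟨hac', hcb, hdb'⟩
            exact ⟨.inr (by linarith), .inl (by linarith)⟩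
          · exact nested hne hac le_rfl h4 h5 e
        · exact (nested (fun h ↦ hne ⟨h.1.symm, h.2.symm⟩) le_rfl hdb h1 h2 e.symm).symm
    · rcases le_total b d with hbd | hbd
      · exact (nested (fun h ↦ hne ⟨h.1.symm, h.2.symm⟩) hac hbd h1 h2 e.symm).symm
      · rcases hac.lt_or_eq with hac' | rfl
        · rcases hbd.lt_or_eq with hbd' | rfl
          · have : d ≤ a := by
              by_contra! hcb
              exact h₂ ⟨hac', hcb, hbd'⟩
            exact ⟨.inl (by linarith), .inr (by linarith)⟩
          · exact (nested (fun h ↦ hne ⟨h.1.symm, h.2.symm⟩) hac le_rfl h1 h2 e.symm).symm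
        · exact nested hne le_rfl hbd h4 h5 e
  refine ⟨?_, key⟩
  rcases key.1 with h | h <;> rw [h, sub_self] at h3 <;> rw [h] <;> linarith

/-- A graph is outerplanar if its vertices can be linearly ordered without crossing edges. -/
theorem isOuterplanar_of_noncrossing_s12 {V : Type} {G : SimpleGraph V} (t : V → ℝ)
    (ht : Function.Injective t) (hcross : ∀ a b c d, G.Adj a b → G.Adj c d →
      t a < t c → t c < t b → ¬ t b < t d) : IsOuterplanar G := by
  let vtx : V → ℝ × ℝ := fun v ↦ (t v, t v ^ 2)
  have hvtx : Function.Injective vtx := fun u v h ↦ ht (Prod.ext_iff.1 h).1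
  have hbelow : ∀ u v, G.Adj u v → ∀ z ∈ segment ℝ (vtx u) (vtx v), z.1 ^ 2 ≤ z.2 ∧
      (z.2 = z.1 ^ 2 → z.1 = t u ∨ z.1 = t v) := by
    intro u v h z hz
    wlog huv : t u < t v generalizing u v
    · exact (this v u h.symm (segment_symm ℝ (vtx u) (vtx v) ▸ hz)
        (lt_of_le_of_ne (not_lt.1 huv) (ht.ne h.ne'))).imp id fun h h' ↦ (h h').symm
    obtain ⟨h1, h2, h3⟩ := mem_segment_parabola huv hz
    refine ⟨by nlinarith, fun h4 ↦ ?_⟩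
    rw [h4, sub_self] at h3
    rcases mul_eq_zero.1 h3.symm with h5 | h5
    · exact .inl (by linarith)
    · exact .inr (by linarith)
  have hinter : ∀ u v a b, G.Adj u v → G.Adj a b → s(u, v) ≠ s(a, b) →
      ∀ z ∈ segment ℝ (vtx u) (vtx v), z ∈ segment ℝ (vtx a) (vtx b) →
      z.2 = z.1 ^ 2 ∧ (z.1 = t u ∨ z.1 = t v) ∧ (z.1 = t a ∨ z.1 = t b) := by
    intro u v a b huv hab hs z hz hz'
    wlog h1 : t u < t v generalizing u v
    · have := this v u huv.symm (by rwa [Sym2.eq_swap]) (segment_symm ℝ (vtx u) (vtx v) ▸ hz)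
        (lt_of_le_of_ne (not_lt.1 h1) (ht.ne huv.ne'))
      tauto
    wlog h2 : t a < t b generalizing a b
    · have := this b a hab.symm (segment_symm ℝ (vtx a) (vtx b) ▸ hz')
        (by rwa [Sym2.eq_swap (a := b)]) (lt_of_le_of_ne (not_lt.1 h2) (ht.ne hab.ne'))
      tauto
    refine segment_parabola_inter h1 h2 ?_ ?_ ?_ hz hz'
    · rintro ⟨h3, h4⟩
      exact hs (by rw [ht h3, ht h4])
    · rintro ⟨h3, h4, h5⟩
      exact hcross u v a b huv hab h3 h4 h5
    · rintro ⟨h3, h4, h5⟩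
      exact hcross a b u v hab huv h3 h4 h5
  let E : PlaneEmbedding G :=
    { vtx := vtx
      vtx_inj := hvtx
      arc := fun u v _ ↦ segment ℝ (vtx u) (vtx v)
      arc_symm := fun u v _ ↦ segment_symm ℝ (vtx v) (vtx u)
      arc_path := fun u v h ↦ ⟨Path.segment _ _, Path.segment_injective_of_ne (hvtx.ne h.ne),
        Path.range_segment _ _⟩
      arc_vtx := fun u v h w hw ↦ ((hbelow u v h _ hw).2 rfl).imp (@ht _ _) (@ht _ _)
      arc_inter := by
        rintro u v a b h₁ h₂ hs z ⟨hz, hz'⟩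
        obtain ⟨h1, h2, h3⟩ := hinter u v a b h₁ h₂ hs z hz hz'
        have hz : ∀ w, z.1 = t w → z = vtx w := fun w hw ↦ Prod.ext hw (by rw [h1, hw])
        exact ⟨h2.imp (hz u) (hz v), h3.imp (hz a) (hz b)⟩ }
  refine ⟨E, fun v _ ↦ ?_⟩
  let U : Set (ℝ × ℝ) := {z | z.2 < z.1 ^ 2}
  have hUE : U ⊆ (E.subSupport Set.univ)ᶜ := by
    intro z hz hzE
    have hz : z.2 < z.1 ^ 2 := hz
    rcases PlaneEmbedding.mem_subSupport.1 hzE with ⟨w, -, rfl⟩ | ⟨u, -, v, -, h, hp⟩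
    · exact lt_irrefl _ hz
    · exact hz.not_ge (hbelow u v h z hp).1
  have hU : IsPreconnected U := by
    have himage : (fun z : ℝ × ℝ ↦ (z.1, z.1 ^ 2 - z.2)) '' (Set.univ ×ˢ Set.Ioi 0) = U := by
      ext z
      constructor
      · rintro ⟨x, ⟨-, hx⟩, rfl⟩
        exact sub_lt_self _ (Set.mem_Ioi.1 hx)
      · intro hz
        refine ⟨(z.1, z.1 ^ 2 - z.2), ⟨trivial, Set.mem_Ioi.2 (sub_pos.2 hz)⟩, ?_⟩
        simp
    rw [← himage]
    exact (isPreconnected_univ.prod isPreconnected_Ioi).image _ (by fun_prop)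
  have hUunb : ¬ Bornology.IsBounded U := by
    intro hb
    obtain ⟨R, hR⟩ := hb.exists_norm_le
    have hmem : ((0 : ℝ), -(|R| + 1)) ∈ U := by
      change -(|R| + 1) < (0 : ℝ) ^ 2
      have := abs_nonneg R
      nlinarith
    have h1 := (norm_snd_le _).trans (hR _ hmem)
    rw [norm_neg, Real.norm_of_nonneg (by positivity)] at h1
    linarith [le_abs_self R]
  have hsub : U ⊆ {p | p ∉ E.subSupport Set.univ ∧
      ¬ Bornology.IsBounded (connectedComponentIn (E.subSupport Set.univ)ᶜ p)} :=
    fun z hz ↦ ⟨hUE hz, fun hb ↦ hUunb (hb.subset (hU.subset_connectedComponentIn hz hUE))⟩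
  refine closure_mono hsub (Metric.mem_closure_iff.2 fun ε hε ↦ ?_)
  refine ⟨(t v, t v ^ 2 - ε / 2), ?_, ?_⟩
  · change t v ^ 2 - ε / 2 < t v ^ 2
    linarith
  · change dist (t v, t v ^ 2) _ < ε
    rw [Prod.dist_eq, Real.dist_eq, Real.dist_eq]
    simp only [sub_self, abs_zero, sub_sub_cancel]
    rw [abs_of_pos (by linarith)]
    exact max_lt hε (by linarith)

/-- A construction order of a `2`-tree: `r` numbers the vertices, and every vertex after the
first two is joined to exactly two earlier vertices, which are adjacent. -/
structure IsTwoTreeOrder {V : Type} (G : SimpleGraph V) (r : V → ℕ) : Prop where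
  inj : Function.Injective r
  base : ∀ u v, r u < 2 → r v < 2 → u ≠ v → G.Adj u v
  step : ∀ w, 2 ≤ r w → ∃ p q, r p < r w ∧ r q < r w ∧ G.Adj p q ∧ G.Adj w p ∧ G.Adj w q ∧
    ∀ i, r i < r w → G.Adj w i → i = p ∨ i = q

theorem IsKTree.exists_isTwoTreeOrder {V : Type} {G : SimpleGraph V} (hG : IsKTree 2 G) :
    Finite V ∧ ∃ r, IsTwoTreeOrder G r := by
  obtain ⟨n, e, hn, hbase, hstep⟩ := hG
  refine ⟨.of_equiv _ e, fun v ↦ e.symm v, ?_, ?_, ?_⟩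
  · exact Fin.val_injective.comp e.symm.injective
  · intro u v hu hv huv
    simpa using hbase (e.symm u) (e.symm v) (by omega) (by omega) (by simpa using huv)
  · intro w hw
    obtain ⟨j, rfl⟩ := e.surjective w
    simp only [Equiv.symm_apply_apply] at hw ⊢
    rcases hw.lt_or_eq with hj | hj
    · obtain ⟨hcard, hadj⟩ := hstep j hj
      obtain ⟨p, q, hpq, hset⟩ := Set.ncard_eq_two.1 hcard
      have hmem : ∀ i, i < j ∧ G.Adj (e i) (e j) ↔ i = p ∨ i = q := fun i ↦ by
        simpa using Set.ext_iff.1 hset i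
      have hp := (hmem p).2 (.inl rfl)
      have hq := (hmem q).2 (.inr rfl)
      refine ⟨e p, e q, by simpa using hp.1, by simpa using hq.1,
        hadj p q hp.1 hq.1 hp.2 hq.2 hpq, hp.2.symm, hq.2.symm, fun i hi hij ↦ ?_⟩
      simpa [Equiv.symm_apply_eq] using (hmem (e.symm i)).1 ⟨hi, by simpa using hij.symm⟩
    · have h0 : (0 : ℕ) < n := by omega
      have h1 : (1 : ℕ) < n := by omega
      refine ⟨e ⟨0, h0⟩, e ⟨1, h1⟩, by simp; omega, by simp; omega, hbase _ _ (by simp) (by simp)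
        (by simp), hbase _ _ (by omega) (by simp) (by simp [Fin.ext_iff]; omega),
        hbase _ _ (by omega) (by simp) (by simp [Fin.ext_iff]; omega), fun i hi _ ↦ ?_⟩
      rw [← Equiv.symm_apply_eq, ← Equiv.symm_apply_eq, Fin.ext_iff, Fin.ext_iff]
      simp only
      omega

/-- The initial segments of a `2`-tree remain connected after deleting a vertex. -/
theorem IsTwoTreeOrder.preconnected_induce {V : Type} {G : SimpleGraph V} {r : V → ℕ}
    (hr : IsTwoTreeOrder G r) (q : V) {m : ℕ} (hm : 2 ≤ m) :
    (G.induce {v | r v < m ∧ v ≠ q}).Preconnected := by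
  induction m, hm using Nat.le_induction with
  | base =>
    intro a b
    by_cases hab : a = b
    · rw [hab]
    · exact SimpleGraph.Adj.reachable
        (hr.base a b a.2.1 b.2.1 fun h ↦ hab (Subtype.ext h))
  | succ m hm ih =>
    have hsub : {v | r v < m ∧ v ≠ q} ⊆ {v | r v < m + 1 ∧ v ≠ q} :=
      fun v hv ↦ ⟨hv.1.trans (Nat.lt_succ_self m), hv.2⟩
    have hdown : ∀ a : {v | r v < m + 1 ∧ v ≠ q}, ∃ b : {v | r v < m ∧ v ≠ q},
        (G.induce {v | r v < m + 1 ∧ v ≠ q}).Reachable a ⟨b, hsub b.2⟩ := by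
      rintro ⟨a, ham, haq⟩
      rcases (Nat.lt_succ_iff.1 ham).lt_or_eq with h | h
      · exact ⟨⟨a, h, haq⟩, .refl _⟩
      · obtain ⟨x, y, hx, hy, hxy, hax, hay, -⟩ := hr.step a (h ▸ hm)
        by_cases hxq : x = q
        · exact ⟨⟨y, h ▸ hy, fun h ↦ hxy.ne (hxq.trans h.symm)⟩, SimpleGraph.Adj.reachable hay⟩
        · exact ⟨⟨x, h ▸ hx, hxq⟩, SimpleGraph.Adj.reachable hax⟩
    intro a b
    obtain ⟨a', ha⟩ := hdown a
    obtain ⟨b', hb⟩ := hdown b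
    exact ha.trans (((ih a' b').map (SimpleGraph.induceHomOfLE G hsub).toHom).trans hb.symm)

/-- Adding an edge to a `2`-tree destroys outerplanarity. -/
theorem IsTwoTreeOrder.not_isOuterplanar_sup {V : Type} [Finite V] {G : SimpleGraph V} {r : V → ℕ}
    (hr : IsTwoTreeOrder G r) {u v : V} (huv : u ≠ v) (hadj : ¬ G.Adj u v) :
    ¬ IsOuterplanar (G ⊔ SimpleGraph.fromEdgeSet {s(u, v)}) := by
  wlog hlt : r v < r u generalizing u v
  · rw [Sym2.eq_swap]
    exact this huv.symm (fun h ↦ hadj h.symm)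
      (lt_of_le_of_ne (not_lt.1 hlt) (hr.inj.ne huv))
  have hu : 2 ≤ r u := by
    by_contra! h
    exact hadj (hr.base u v h (hlt.trans h) huv)
  obtain ⟨p, q, hp, hq, hpq, hup, huq, -⟩ := hr.step u hu
  have hvp : v ≠ p := by rintro rfl; exact hadj hup
  have hvq : v ≠ q := by rintro rfl; exact hadj huq
  have hle : G ≤ G ⊔ SimpleGraph.fromEdgeSet {s(u, v)} := le_sup_left
  have hmono : ∀ {S : Set V}, G.induce S ≤ (G ⊔ SimpleGraph.fromEdgeSet {s(u, v)}).induce S :=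
    by intro S a b h; exact hle h
  refine not_isOuterplanar_of_subdivision_K4 (u := u) (v := v) (x := p) (y := q)
    (S := {w | r w < r u ∧ w ≠ q}) (T := {w | r w < r u ∧ w ≠ p})
    (by simp [huv]) (hle hpq) (hle hup) (hle huq) ⟨hlt, hvq⟩ ⟨hlt, hvp⟩ ⟨hp, hpq.ne⟩
    ⟨hq, hpq.ne'⟩ ((hr.preconnected_induce q hu _ _).mono hmono)
    ((hr.preconnected_induce p hu _ _).mono hmono) ?_ ?_ ?_ ?_ <;> simp

/-- The position `t` places the vertices in `A` on a line without crossing edges, such that every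
edge with a vertex strictly inside (outside) it is in a triangle with apex strictly inside
(outside). -/
structure IsPolygonOrder {V : Type} (G : SimpleGraph V) (A : Set V) (t : V → ℝ) : Prop where
  inj : Set.InjOn t A
  cross : ∀ a ∈ A, ∀ b ∈ A, ∀ c ∈ A, ∀ d ∈ A, G.Adj a b → G.Adj c d →
    t a < t c → t c < t b → ¬ t b < t d
  inside : ∀ a ∈ A, ∀ b ∈ A, ∀ x ∈ A, G.Adj a b → t a < t x → t x < t b →
    ∃ z ∈ A, G.Adj z a ∧ G.Adj z b ∧ t a < t z ∧ t z < t b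
  outside : ∀ a ∈ A, ∀ b ∈ A, ∀ x ∈ A, G.Adj a b → t a < t b → (t x < t a ∨ t b < t x) →
    ∃ z ∈ A, G.Adj z a ∧ G.Adj z b ∧ (t z < t a ∨ t b < t z)

/-- A polygon order extends to a vertex which is glued to an edge of the polygon. -/
theorem IsPolygonOrder.insert {V : Type} {G : SimpleGraph V} {A : Set V} {t : V → ℝ}
    (h : IsPolygonOrder G A t) {w p q : V} (hw : w ∉ A) (hp : p ∈ A) (hq : q ∈ A)
    (hpq : G.Adj p q) (hwp : G.Adj w p) (hwq : G.Adj w q)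
    (honly : ∀ i ∈ A, G.Adj w i → i = p ∨ i = q) (hlt : t p < t q)
    (hside : (∀ x ∈ A, t x ≤ t p ∨ t q ≤ t x) ∨ (∀ x ∈ A, t p ≤ t x ∧ t x ≤ t q)) :
    ∃ t', IsPolygonOrder G (insert w A) t' := by
  obtain ⟨τ, hτ⟩ : ∃ τ, (t p < τ ∧ τ < t q ∧ ∀ x ∈ A, t x ≤ t p ∨ t q ≤ t x) ∨
      (t q < τ ∧ ∀ x ∈ A, t p ≤ t x ∧ t x ≤ t q) := by
    rcases hside with hs | hs
    · obtain ⟨τ, h1, h2⟩ := exists_between hlt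
      exact ⟨τ, .inl ⟨h1, h2, hs⟩⟩
    · exact ⟨t q + 1, .inr ⟨by linarith, hs⟩⟩
  classical
  obtain ⟨t', htw, htA⟩ : ∃ t' : V → ℝ, t' w = τ ∧ ∀ x ∈ A, t' x = t x :=
    ⟨Function.update t w τ, by simp,
      fun x hx ↦ Function.update_of_ne (by rintro rfl; exact hw hx) _ _⟩
  have honly' : ∀ i ∈ A, G.Adj i w → i = p ∨ i = q := fun i hi h ↦ honly i hi h.symm
  have hirr : ¬ G.Adj w w := G.irrefl
  have hinj := h.inj
  refine ⟨t', ?_, ?_, ?_, ?_⟩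
  · rintro a (rfl | ha) b (rfl | hb) hab
    · rfl
    · grind
    · grind
    · exact h.inj ha hb (by rw [← htA a ha, ← htA b hb, hab])
  · rintro a (rfl | ha) b (rfl | hb) c (rfl | hc) d (rfl | hd) hab hcd h1 h2 h3
    all_goals first
      | exact hirr hab
      | exact hirr hcd
      | exact lt_irrefl _ h1
      | exact lt_irrefl _ h2
      | exact lt_irrefl _ h3
      | skip
    all_goals first
      | exact h.cross a ha b hb c hc d hd hab hcd (by rwa [← htA a ha, ← htA c hc])
          (by rwa [← htA c hc, ← htA b hb]) (by rwa [← htA b hb, ← htA d hd])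
      | grind
  · intro a ha b hb x hx hab h1 h2
    by_cases hAll : a ∈ A ∧ b ∈ A ∧ ∃ y ∈ A, t a < t y ∧ t y < t b
    · obtain ⟨haA, hbA, y, hy, h3, h4⟩ := hAll
      obtain ⟨z, hz, hza, hzb, h5, h6⟩ := h.inside a haA b hbA y hy hab h3 h4
      exact ⟨z, .inr hz, hza, hzb, by rwa [htA a haA, htA z hz], by rwa [htA b hbA, htA z hz]⟩
    rw [not_and, not_and] at hAll
    rcases ha with ha | ha <;> rcases hb with hb | hb
    · exact (hirr (by rwa [ha, hb] at hab)).elim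
    · exfalso
      rcases hx with hx | hx <;> grind
    · obtain rfl | rfl := honly' a ha (hb ▸ hab)
      · refine ⟨q, .inr hq, hpq.symm, hb ▸ hwq.symm, ?_⟩
        rcases hx with hx | hx <;> grind
      · exfalso
        rcases hx with hx | hx <;> grind
    · rcases hx with hx | hx
      · have haτ : t a < τ := by rwa [htA a ha, hx, htw] at h1
        have hbτ : τ < t b := by rwa [htA b hb, hx, htw] at h2
        obtain ⟨rfl, rfl⟩ : a = p ∧ b = q := by
          rcases hτ with ⟨h3, h4, hs⟩ | ⟨h3, hs⟩
          · have hap : t a ≤ t p := (hs a ha).resolve_right (by linarith)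
            have hqb : t q ≤ t b := (hs b hb).resolve_left (by linarith)
            exact ⟨h.inj ha hp (hap.eq_of_not_lt fun hlt ↦ hAll ha hb ⟨p, hp, hlt, by linarith⟩),
              (h.inj hq hb (hqb.eq_of_not_lt fun hlt ↦ hAll ha hb ⟨q, hq, by linarith, hlt⟩)).symm⟩
          · linarith [(hs b hb).2]
        exact ⟨w, .inl rfl, hwp, hwq, hx ▸ h1, hx ▸ h2⟩
      · grind
  · intro a ha b hb x hx hab hlt' h1
    by_cases hAll : a ∈ A ∧ b ∈ A ∧ ∃ y ∈ A, t y < t a ∨ t b < t y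
    · obtain ⟨haA, hbA, y, hy, h3⟩ := hAll
      obtain ⟨z, hz, hza, hzb, h5⟩ := h.outside a haA b hbA y hy hab
        (by rwa [← htA a haA, ← htA b hbA]) h3
      exact ⟨z, .inr hz, hza, hzb, by rwa [htA a haA, htA b hbA, htA z hz]⟩
    rw [not_and, not_and] at hAll
    rcases ha with ha | ha <;> rcases hb with hb | hb
    · exact (hirr (by rwa [ha, hb] at hab)).elim
    · obtain rfl | rfl := honly b hb (ha ▸ hab)
      · exfalso
        rcases hx with hx | hx <;> grind
      · refine ⟨p, .inr hp, ha ▸ hwp.symm, hpq, ?_⟩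
        rcases hx with hx | hx <;> grind
    · obtain rfl | rfl := honly' a ha (hb ▸ hab)
      · refine ⟨q, .inr hq, hpq.symm, hb ▸ hwq.symm, ?_⟩
        rcases hx with hx | hx <;> grind
      · refine ⟨p, .inr hp, hpq, hb ▸ hwp.symm, ?_⟩
        rcases hx with hx | hx <;> grind
    · rcases hx with hx | hx
      · rw [htA a ha, htA b hb, hx, htw] at h1
        have hpa : t a ≤ t p := not_lt.1 fun hlt ↦ hAll ha hb ⟨p, hp, .inl hlt⟩
        have hqb : t q ≤ t b := not_lt.1 fun hlt ↦ hAll ha hb ⟨q, hq, .inr hlt⟩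
        obtain ⟨rfl, rfl⟩ : a = p ∧ b = q := by
          rcases hτ with ⟨h3, h4, hs⟩ | ⟨h3, hs⟩
          · rcases h1 with h1 | h1 <;> linarith
          · exact ⟨h.inj ha hp (hpa.antisymm (hs a ha).1), h.inj hb hq ((hs b hb).2.antisymm hqb)⟩
        exact ⟨w, .inl rfl, hwp, hwq, by rwa [htA a ha, htA b hb, htw]⟩
      · grind

theorem containsCopy_K113_of_common_neighbors {V : Type} {G : SimpleGraph V} {p q x y z : V}
    (hpq : G.Adj p q) (hxp : G.Adj x p) (hxq : G.Adj x q) (hyp : G.Adj y p) (hyq : G.Adj y q)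
    (hzp : G.Adj z p) (hzq : G.Adj z q) (hxy : x ≠ y) (hxz : x ≠ z) (hyz : y ≠ z) :
    ContainsCopy K113 G := by
  refine ⟨⟨![p, q, x, y, z], fun {a b} hab ↦ ?_⟩, fun a b hab ↦ ?_⟩
  · fin_cases a <;> fin_cases b <;> simp [K113] at hab ⊢ <;> simp_all [SimpleGraph.adj_comm]
  · have := hpq.ne
    have := hxp.ne
    have := hxq.ne
    have := hyp.ne
    have := hyq.ne
    have := hzp.ne
    have := hzq.ne
    fin_cases a <;> fin_cases b <;> simp_all

/-- The initial segments of a `2`-tree without `K_{1,1,3}` have a polygon order. -/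
theorem IsTwoTreeOrder.exists_isPolygonOrder {V : Type} {G : SimpleGraph V} {r : V → ℕ}
    (hr : IsTwoTreeOrder G r) (hfree : ¬ ContainsCopy K113 G) {m : ℕ} (hm : 2 ≤ m) :
    ∃ t, IsPolygonOrder G {v | r v < m} t := by
  induction m, hm using Nat.le_induction with
  | base =>
    refine ⟨fun v ↦ r v, fun a _ b _ hab ↦ hr.inj (Nat.cast_injective hab), ?_, ?_, ?_⟩
    · intro a ha b hb c hc d hd _ _ h1 h2 h3
      simp only [Set.mem_ofPred_eq, Nat.cast_lt] at *
      omega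
    · intro a ha b hb x hx _ h1 h2
      simp only [Set.mem_ofPred_eq, Nat.cast_lt] at *
      omega
    · intro a ha b hb x hx _ h1 h2
      simp only [Set.mem_ofPred_eq, Nat.cast_lt] at *
      omega
  | succ m hm ih =>
    obtain ⟨t, ht⟩ := ih
    by_cases hw : ∃ w, r w = m
    · obtain ⟨w, rfl⟩ := hw
      have hset : {v | r v < r w + 1} = insert w {v | r v < r w} := by
        ext v
        simp only [Set.mem_ofPred_eq, Set.mem_insert_iff, Nat.lt_succ_iff, le_iff_eq_or_lt,
          hr.inj.eq_iff]
      rw [hset]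
      obtain ⟨p, q, hp, hq, hpq, hwp, hwq, honly⟩ := hr.step w hm
      wlog hlt : t p < t q generalizing p q
      · exact this q p hq hp hpq.symm hwq hwp (fun i hi h ↦ (honly i hi h).symm)
          (lt_of_le_of_ne (not_lt.1 hlt) (ht.inj.ne hq hp hpq.ne'))
      refine ht.insert (lt_irrefl (r w)) hp hq hpq hwp hwq honly hlt ?_
      by_contra! hside
      obtain ⟨⟨x, hx, hpx, hxq⟩, y, hy, hy'⟩ := hside
      obtain ⟨z, hz, hzp, hzq, h1, h2⟩ := ht.inside p hp q hq x hx hpq hpx hxq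
      obtain ⟨z', hz', hzp', hzq', h3⟩ := ht.outside p hp q hq y hy hpq hlt
        ((lt_or_ge (t y) (t p)).imp_right hy')
      refine hfree (containsCopy_K113_of_common_neighbors hpq hzp hzq hzp' hzq' hwp hwq ?_ ?_ ?_)
      · rintro rfl
        rcases h3 with h3 | h3 <;> linarith
      · rintro rfl
        exact lt_irrefl (r z) hz
      · rintro rfl
        exact lt_irrefl (r z') hz'
    · have hset : {v | r v < m + 1} = {v | r v < m} := by
        ext v
        have : r v ≠ m := fun h ↦ hw ⟨v, h⟩
        simp only [Set.mem_ofPred_eq]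
        omega
      exact ⟨t, hset ▸ ht⟩

theorem IsTwoTreeOrder.isOuterplanar {V : Type} [Finite V] {G : SimpleGraph V} {r : V → ℕ}
    (hr : IsTwoTreeOrder G r) (hfree : ¬ ContainsCopy K113 G) : IsOuterplanar G := by
  obtain ⟨M, hM⟩ := (Set.finite_range r).bddAbove
  obtain ⟨t, ht⟩ := hr.exists_isPolygonOrder hfree (m := M + 2) (by omega)
  have hmem : ∀ v, r v < M + 2 := fun v ↦ by
    have : r v ≤ M := hM ⟨v, rfl⟩
    omega
  exact isOuterplanar_of_noncrossing_s12 t (fun a b hab ↦ ht.inj (hmem a) (hmem b) hab)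
    fun a b c d ↦ ht.cross a (hmem a) b (hmem b) c (hmem c) d (hmem d)

/-- A `2`-tree `G` is not a maximal outerplanar graph iff `G`
contains a subgraph isomorphic to `K_{1,1,3}`; equivalently, a `2`-tree is outerplanar
iff it contains no subgraph isomorphic to `K_{1,1,3}`. -/
theorem stmt12 (V : Type) (G : SimpleGraph V) (hG : IsKTree 2 G) :
    (¬ IsMaximalOuterplanar G ↔ ContainsCopy K113 G) ∧
    (IsOuterplanar G ↔ ¬ ContainsCopy K113 G) := by
  obtain ⟨_, r, hr⟩ := hG.exists_isTwoTreeOrder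
  have hfree : IsOuterplanar G ↔ ¬ ContainsCopy K113 G :=
    ⟨fun h ↦ h.not_containsCopy_K113, hr.isOuterplanar⟩
  have hmax : IsMaximalOuterplanar G ↔ IsOuterplanar G :=
    ⟨fun h ↦ h.1, fun h ↦ ⟨h, fun u v huv hadj ↦ hr.not_isOuterplanar_sup huv hadj⟩⟩
  exact ⟨by rw [hmax, hfree, not_not], hfree⟩
end
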